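/- arXiv:math/0305232 — 5 statements merged into one kernel-verified Lean document; each statement's English description precedes it below -/
import Mathlib

section
/- Let F be a field of characteristic 0 and f : ℝ² → F² a unit-distance preserving map. If t is a rational number with 0 < t < 1, A, B ∈ ℝ² with A ≠ B, and C = t·A + (1−t)·B, then f(C) = t·f(A) + (1−t)·f(B), where the rational t acts on F² via the canonical embedding ℚ → F (Theorem 5). -/
/-- The algebraic core of the rhombus argument: `p, q, p - q` are unit vectors of `F²` and `y` is at
unit distance from `p` and `q`. Then `y = 0` or `y = p + q`. -/
lemma rhombus_alg {F : Type*} [Field F] [CharZero F] (p1 p2 q1 q2 y1 y2 : F)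
    (hp : p1 ^ 2 + p2 ^ 2 = 1) (hq : q1 ^ 2 + q2 ^ 2 = 1)
    (hpq : (p1 - q1) ^ 2 + (p2 - q2) ^ 2 = 1)
    (hyp : (y1 - p1) ^ 2 + (y2 - p2) ^ 2 = 1)
    (hyq : (y1 - q1) ^ 2 + (y2 - q2) ^ 2 = 1) :
    (y1 = 0 ∧ y2 = 0) ∨ (y1 = p1 + q1 ∧ y2 = p2 + q2) := by
  have two : (2 : F) ≠ 0 := two_ne_zero
  obtain ⟨d1, hd1⟩ : ∃ d, d = p1 - q1 := ⟨_, rfl⟩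
  obtain ⟨d2, hd2⟩ : ∃ d, d = p2 - q2 := ⟨_, rfl⟩
  obtain ⟨e, he⟩ : ∃ e, e = y2 * d1 - y1 * d2 := ⟨_, rfl⟩
  obtain ⟨m, hm⟩ : ∃ m, m = (p2 + q2) * d1 - (p1 + q1) * d2 := ⟨_, rfl⟩
  have hd : d1 ^ 2 + d2 ^ 2 = 1 := by rw [hd1, hd2]; exact hpq
  have hyd : y1 * d1 + y2 * d2 = 0 := by
    apply mul_left_cancel₀ two
    rw [hd1, hd2]; linear_combination hyq - hyp + hp - hq
  have hsd : (p1 + q1) * d1 + (p2 + q2) * d2 = 0 := by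
    rw [hd1, hd2]; linear_combination hp - hq
  have hy1 : y1 = - e * d2 := by
    rw [he]; linear_combination d1 * hyd - y1 * hd
  have hy2 : y2 = e * d1 := by
    rw [he]; linear_combination d2 * hyd - y2 * hd
  have hs1 : p1 + q1 = - m * d2 := by
    rw [hm]; linear_combination d1 * hsd - (p1 + q1) * hd
  have hs2 : p2 + q2 = m * d1 := by
    rw [hm]; linear_combination d2 * hsd - (p2 + q2) * hd
  have hyy : y1 ^ 2 + y2 ^ 2 = y1 * (p1 + q1) + y2 * (p2 + q2) := by
    apply mul_left_cancel₀ two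
    linear_combination hyq + hyp - hp - hq
  have hem : e * (e - m) = 0 := by
    rw [hs1, hs2, hy1, hy2] at hyy
    linear_combination hyy - (e * (e - m)) * hd
  rcases mul_eq_zero.1 hem with h | h
  · left; rw [hy1, hy2, h]; simp
  · right
    have : e = m := sub_eq_zero.1 h
    rw [hs1, hs2, hy1, hy2, this]; simp

/-- The subgroup of `ℂ` generated by the unit vectors is everything. -/
lemma unit_gen (S : AddSubgroup ℂ) (hS : ∀ v : ℂ, ‖v‖ = 1 → v ∈ S) (z : ℂ) : z ∈ S := by
  by_cases hz : z = 0
  · rw [hz]; exact S.zero_mem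
  have hz0 : (0 : ℝ) < ‖z‖ := norm_pos_iff.2 hz
  obtain ⟨N, hN⟩ := exists_nat_gt ‖z‖
  have hN0 : (0 : ℝ) < N := hz0.trans hN
  obtain ⟨c, hc⟩ : ∃ c : ℝ, c = ‖z‖ / (2 * N) := ⟨_, rfl⟩
  have hc0 : 0 ≤ c := by rw [hc]; positivity
  have hc1 : c ≤ 1 := by
    rw [hc, div_le_one (by positivity)]; linarith
  obtain ⟨s, hs⟩ : ∃ s : ℝ, c ^ 2 + s ^ 2 = 1 :=
    ⟨√(1 - c ^ 2), by rw [Real.sq_sqrt (by nlinarith)]; ring⟩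
  have hu : ‖z / (‖z‖ : ℂ)‖ = 1 := by
    rw [norm_div, Complex.norm_real, norm_norm, div_self hz0.ne']
  have n1 : ‖(⟨c, s⟩ : ℂ)‖ = 1 := by
    rw [Complex.norm_eq_sqrt_sq_add_sq, hs, Real.sqrt_one]
  have n2 : ‖(⟨c, -s⟩ : ℂ)‖ = 1 := by
    rw [Complex.norm_eq_sqrt_sq_add_sq, neg_sq, hs, Real.sqrt_one]
  have m1 := hS (z / (‖z‖ : ℂ) * ⟨c, s⟩) (by rw [norm_mul, hu, n1, one_mul])
  have m2 := hS (z / (‖z‖ : ℂ) * ⟨c, -s⟩) (by rw [norm_mul, hu, n2, one_mul])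
  have m3 := S.nsmul_mem (S.add_mem m1 m2) N
  have hsum : (⟨c, s⟩ : ℂ) + ⟨c, -s⟩ = ((2 * c : ℝ) : ℂ) := by
    apply Complex.ext <;> simp; ring
  have : N • (z / (‖z‖ : ℂ) * ⟨c, s⟩ + z / (‖z‖ : ℂ) * ⟨c, -s⟩) = z := by
    rw [← mul_add, hsum, hc, nsmul_eq_mul]
    have h1 : (‖z‖ : ℂ) ≠ 0 := by exact_mod_cast hz0.ne'
    have h2 : (N : ℂ) ≠ 0 := by exact_mod_cast hN0.ne'
    push_cast
    field_simp
  rwa [this] at m3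

section core

variable {F : Type*} [Field F] [CharZero F]

/-- The primitive sixth root of unity and the rotation of the Moser spindle. -/
lemma exists_rot : ∃ w r : ℂ, ‖w‖ = 1 ∧ ‖w - 1‖ = 1 ∧ ‖r‖ = 1 ∧ ‖(1 + w) * (r - 1)‖ = 1 := by
  have h3 : √3 ^ 2 = (3 : ℝ) := Real.sq_sqrt (by norm_num)
  have h11 : √11 ^ 2 = (11 : ℝ) := Real.sq_sqrt (by norm_num)
  refine ⟨⟨1 / 2, √3 / 2⟩, ⟨5 / 6, √11 / 6⟩, ?_, ?_, ?_, ?_⟩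
  · rw [Complex.norm_eq_sqrt_sq_add_sq, Real.sqrt_eq_one]; simp only; linarith
  · rw [Complex.norm_eq_sqrt_sq_add_sq, Real.sqrt_eq_one]; simp; linarith
  · rw [Complex.norm_eq_sqrt_sq_add_sq, Real.sqrt_eq_one]; simp only; linarith
  · rw [norm_mul, Complex.norm_eq_sqrt_sq_add_sq, Complex.norm_eq_sqrt_sq_add_sq,
      ← Real.sqrt_mul (by positivity), Real.sqrt_eq_one]
    simp only [Complex.add_re, Complex.add_im, Complex.sub_re, Complex.sub_im, Complex.one_re,
      Complex.one_im]
    have e1 : (1 + 1 / 2 : ℝ) ^ 2 + (0 + √3 / 2) ^ 2 = 3 := by linarith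
    have e2 : (5 / 6 - 1 : ℝ) ^ 2 + (√11 / 6 - 0) ^ 2 = 1 / 3 := by linarith
    rw [e1, e2]; norm_num

lemma rhombus (g h : ℂ → F)
    (H : ∀ x v : ℂ, ‖v‖ = 1 → (g (x + v) - g x) ^ 2 + (h (x + v) - h x) ^ 2 = 1)
    (w : ℂ) (hw : ‖w‖ = 1) (hw1 : ‖w - 1‖ = 1) (x v : ℂ) (hv : ‖v‖ = 1) :
    (g (x + (1 + w) * v) = g x ∧ h (x + (1 + w) * v) = h x) ∨
    ((g (x + (1 + w) * v) + g x = g (x + v) + g (x + w * v) ∧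
      h (x + (1 + w) * v) + h x = h (x + v) + h (x + w * v)) ∧
      (g (x + (1 + w) * v) - g x) ^ 2 + (h (x + (1 + w) * v) - h x) ^ 2 = 3) := by
  have hwv : ‖w * v‖ = 1 := by rw [norm_mul, hw, hv, one_mul]
  have a1 := H x v hv
  have a2 := H x (w * v) hwv
  have a3 := H (x + w * v) ((1 - w) * v) (by rw [norm_mul, norm_sub_rev, hw1, hv, one_mul])
  have a4 := H (x + v) (w * v) hwv
  have a5 := H (x + w * v) v hv
  rw [show x + w * v + (1 - w) * v = x + v by ring] at a3
  rw [show x + v + w * v = x + (1 + w) * v by ring] at a4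
  rw [show x + w * v + v = x + (1 + w) * v by ring] at a5
  generalize x + (1 + w) * v = y at *
  generalize x + w * v = q at *
  generalize x + v = p at *
  rcases rhombus_alg (g p - g x) (h p - h x) (g q - g x) (h q - h x) (g y - g x) (h y - h x)
    a1 a2 (by linear_combination a3) (by linear_combination a4) (by linear_combination a5) with
    ⟨e1, e2⟩ | ⟨e1, e2⟩
  · left; exact ⟨sub_eq_zero.1 e1, sub_eq_zero.1 e2⟩
  · right
    refine ⟨⟨by linear_combination e1, by linear_combination e2⟩, ?_⟩
    rw [e1, e2]; linear_combination 2 * a1 + 2 * a2 - a3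

lemma rhombus' (g h : ℂ → F)
    (H : ∀ x v : ℂ, ‖v‖ = 1 → (g (x + v) - g x) ^ 2 + (h (x + v) - h x) ^ 2 = 1)
    (w r : ℂ) (hw : ‖w‖ = 1) (hw1 : ‖w - 1‖ = 1) (hr : ‖r‖ = 1)
    (hr1 : ‖(1 + w) * (r - 1)‖ = 1) (x v : ℂ) (hv : ‖v‖ = 1) :
    g (x + (1 + w) * v) + g x = g (x + v) + g (x + w * v) ∧
      h (x + (1 + w) * v) + h x = h (x + v) + h (x + w * v) := by
  rcases rhombus g h H w hw hw1 x v hv with ⟨e1, e2⟩ | ⟨e, -⟩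
  · exfalso
    have b := H (x + (1 + w) * v) ((1 + w) * (r - 1) * v) (by rw [norm_mul, hr1, hv, one_mul])
    rw [show x + (1 + w) * v + (1 + w) * (r - 1) * v = x + (1 + w) * (r * v) by ring, e1, e2] at b
    rcases rhombus g h H w hw hw1 x (r * v) (by rw [norm_mul, hr, hv, one_mul]) with
      ⟨c1, c2⟩ | ⟨-, c⟩
    · rw [c1, c2] at b; simp at b
    · rw [b] at c; norm_num at c
  · exact e

lemma double_step (g h : ℂ → F)
    (H : ∀ x v : ℂ, ‖v‖ = 1 → (g (x + v) - g x) ^ 2 + (h (x + v) - h x) ^ 2 = 1)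
    (x v : ℂ) (hv : ‖v‖ = 1) :
    g (x + 2 * v) + g x = 2 * g (x + v) ∧ h (x + 2 * v) + h x = 2 * h (x + v) := by
  obtain ⟨w, r, hw, hw1, hr, hr1⟩ := exists_rot
  obtain ⟨a1, a2⟩ := rhombus' g h H w r hw hw1 hr hr1 x v hv
  -- second rhombus: based at `x + w v`, with sides `v` and `(1 - w) v`, where `1 - w = w⁻¹`
  have key : (1 - w) * w = 1 := by
    have k1 : w.re ^ 2 + w.im ^ 2 = 1 := by
      rw [Complex.norm_eq_sqrt_sq_add_sq, Real.sqrt_eq_one] at hw; exact hw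
    have k2 : (w.re - 1) ^ 2 + w.im ^ 2 = 1 := by
      rw [Complex.norm_eq_sqrt_sq_add_sq, Real.sqrt_eq_one] at hw1; simpa using hw1
    have k3 : w.re = 1 / 2 := by linarith
    have k4 : w.im ^ 2 = 3 / 4 := by rw [k3] at k1; linarith
    apply Complex.ext
    · simp [k3]; linarith
    · simp [k3]; ring
  obtain ⟨b1, b2⟩ := rhombus' g h H w r hw hw1 hr hr1 (x + w * v) ((1 - w) * v)
    (by rw [norm_mul, norm_sub_rev, hw1, hv, one_mul])
  rw [show x + w * v + (1 + w) * ((1 - w) * v) = x + 2 * v by linear_combination v * key,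
    show x + w * v + (1 - w) * v = x + v by ring,
    show x + w * v + w * ((1 - w) * v) = x + (1 + w) * v by linear_combination v * key] at b1 b2
  exact ⟨by linear_combination a1 + b1, by linear_combination a2 + b2⟩

lemma translate_unit (g h : ℂ → F)
    (H : ∀ x v : ℂ, ‖v‖ = 1 → (g (x + v) - g x) ^ 2 + (h (x + v) - h x) ^ 2 = 1)
    (x u v : ℂ) (hu : ‖u‖ = 1) (hv : ‖v‖ = 1) :
    g (x + u + v) - g (x + u) = g (x + v) - g x ∧
    h (x + u + v) - h (x + u) = h (x + v) - h x := by
  obtain ⟨c1, c2⟩ := double_step g h H x v hv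
  obtain ⟨d1, d2⟩ := double_step g h H (x + u) v hv
  have a0 := H x u hu
  have a1 := H (x + v) u hu
  have a2 := H (x + 2 * v) u hu
  rw [show x + v + u = x + u + v by ring] at a1
  rw [show x + 2 * v + u = x + u + 2 * v by ring] at a2
  obtain ⟨p1, hp1⟩ : ∃ p, p = g (x + u) - g x := ⟨_, rfl⟩
  obtain ⟨p2, hp2⟩ : ∃ p, p = h (x + u) - h x := ⟨_, rfl⟩
  obtain ⟨w1, hw1⟩ : ∃ p, p = (g (x + u + v) - g (x + u)) - (g (x + v) - g x) := ⟨_, rfl⟩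
  obtain ⟨w2, hw2⟩ : ∃ p, p = (h (x + u + v) - h (x + u)) - (h (x + v) - h x) := ⟨_, rfl⟩
  rw [← hp1, ← hp2] at a0
  rw [show g (x + u + v) - g (x + v) = p1 + w1 by rw [hp1, hw1]; ring,
    show h (x + u + v) - h (x + v) = p2 + w2 by rw [hp2, hw2]; ring] at a1
  rw [show g (x + u + 2 * v) - g (x + 2 * v) = p1 + 2 * w1 by
      rw [hp1, hw1]; linear_combination d1 - c1,
    show h (x + u + 2 * v) - h (x + 2 * v) = p2 + 2 * w2 by
      rw [hp2, hw2]; linear_combination d2 - c2] at a2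
  have two : (2 : F) ≠ 0 := two_ne_zero
  have hn : w1 ^ 2 + w2 ^ 2 = 0 := by
    apply mul_left_cancel₀ two
    linear_combination a2 - 2 * a1 + a0
  have ho : p1 * w1 + p2 * w2 = 0 := by
    apply mul_left_cancel₀ two
    linear_combination a1 - a0 - hn
  have hx : p1 * w2 - p2 * w1 = 0 := by
    have : (p1 * w2 - p2 * w1) ^ 2 = 0 := by
      linear_combination (p1 ^ 2 + p2 ^ 2) * hn - (p1 * w1 + p2 * w2) * ho
    exact pow_eq_zero_iff (two_ne_zero) |>.1 this
  have e1 : w1 = 0 := by linear_combination p1 * ho - p2 * hx - w1 * a0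
  have e2 : w2 = 0 := by linear_combination p2 * ho + p1 * hx - w2 * a0
  exact ⟨sub_eq_zero.1 (hw1 ▸ e1), sub_eq_zero.1 (hw2 ▸ e2)⟩

/-- Invariance of increments, for one component function. -/
lemma additive_of_unit (g : ℂ → F)
    (T : ∀ x u v : ℂ, ‖u‖ = 1 → ‖v‖ = 1 → g (x + u + v) - g (x + u) = g (x + v) - g x)
    (x y : ℂ) : g (x + y) - g 0 = (g x - g 0) + (g y - g 0) := by
  have T1 : ∀ v : ℂ, ‖v‖ = 1 → ∀ d x : ℂ, g (x + d + v) - g (x + d) = g (x + v) - g x := by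
    intro v hv d
    let S : AddSubgroup ℂ :=
      { carrier := {d | ∀ x : ℂ, g (x + d + v) - g (x + d) = g (x + v) - g x}
        zero_mem' := by intro x; simp
        add_mem' := by
          intro a b ha hb x
          rw [← add_assoc, hb (x + a), ha x]
        neg_mem' := by
          intro a ha x
          have := ha (x + -a)
          rw [neg_add_cancel_right] at this
          exact this.symm }
    exact unit_gen S (fun u hu x => T x u v hu hv) d
  have T2 : ∀ v x d : ℂ, g (x + d + v) - g (x + d) = g (x + v) - g x := by
    intro v
    let S : AddSubgroup ℂ :=
      { carrier := {v | ∀ x d : ℂ, g (x + d + v) - g (x + d) = g (x + v) - g x}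
        zero_mem' := by intro x d; simp
        add_mem' := by
          intro a b ha hb x d
          have h1 := ha x d
          have h2 := hb (x + a) d
          rw [show x + a + d = x + d + a by ring] at h2
          rw [← add_assoc, ← add_assoc]
          linear_combination h1 + h2
        neg_mem' := by
          intro a ha x d
          have := ha (x + -a) d
          rw [show x + -a + d + a = x + d by ring, neg_add_cancel_right,
            show x + -a + d = x + d + -a by ring] at this
          linear_combination -this }
    exact unit_gen S (fun u hu x d => T1 u hu d x) v
  have := T2 y 0 x
  rw [zero_add, zero_add] at this
  linear_combination this

end core

/-- **Theorem 5.** If `t ∈ ℚ`, `0 < t < 1`, `A, B ∈ ℝ²`, `A ≠ B`,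
`C = t·A + (1 - t)·B` and `f : ℝ² → F²` preserves unit distance, then
`f C = t·(f A) + (1 - t)·(f B)`, where `t` acts on `F²` via the canonical
embedding `ℚ → F`. -/
theorem stmt_15 (F : Type*) [Field F] [CharZero F]
    (f : EuclideanSpace ℝ (Fin 2) → (Fin 2 → F))
    (hf : ∀ x y : EuclideanSpace ℝ (Fin 2), dist x y = 1 →
      ∑ i, (f x i - f y i) ^ 2 = 1)
    (t : ℚ) (ht0 : 0 < t) (ht1 : t < 1)
    (A B C : EuclideanSpace ℝ (Fin 2)) (hAB : A ≠ B)
    (hC : C = (t : ℝ) • A + (1 - (t : ℝ)) • B) :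
    f C = (t : F) • f A + (1 - (t : F)) • f B := by
  let e : ℂ ≃ₗᵢ[ℝ] EuclideanSpace ℝ (Fin 2) := Complex.orthonormalBasisOneI.repr
  have H : ∀ x v : ℂ, ‖v‖ = 1 →
      (f (e (x + v)) 0 - f (e x) 0) ^ 2 + (f (e (x + v)) 1 - f (e x) 1) ^ 2 = 1 := by
    intro x v hv
    have := hf (e (x + v)) (e x) (by rw [e.dist_map, dist_eq_norm, add_sub_cancel_left, hv])
    rwa [Fin.sum_univ_two] at this
  have T := translate_unit (fun z => f (e z) 0) (fun z => f (e z) 1) H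
  have add0 := additive_of_unit (fun z => f (e z) 0) (fun x u v hu hv => (T x u v hu hv).1)
  have add1 := additive_of_unit (fun z => f (e z) 1) (fun x u v hu hv => (T x u v hu hv).2)
  have hadd : ∀ x y : EuclideanSpace ℝ (Fin 2),
      f (x + y) - f 0 = (f x - f 0) + (f y - f 0) := by
    intro x y
    have h0 := add0 (e.symm x) (e.symm y)
    have h1 := add1 (e.symm x) (e.symm y)
    simp only [map_add, map_zero, LinearIsometryEquiv.apply_symm_apply] at h0 h1
    ext i
    fin_cases i
    · exact h0
    · exact h1
  let D : EuclideanSpace ℝ (Fin 2) →+ (Fin 2 → F) :=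
    { toFun := fun x => f x - f 0
      map_zero' := sub_self _
      map_add' := hadd }
  have hD : ∀ x, f x = D x + f 0 := fun x => (sub_add_cancel _ _).symm
  have h1 : D ((t : ℝ) • A) = (t : F) • D A := map_ratCast_smul D ℝ F t A
  have h2 : D ((1 - (t : ℝ)) • B) = (1 - (t : F)) • D B := by
    have := map_ratCast_smul D ℝ F (1 - t) B
    push_cast at this
    exact this
  rw [hD C, hD A, hD B, hC, map_add, h1, h2]
  ext i
  simp only [Pi.add_apply, Pi.smul_apply, smul_eq_mul]
  ring
end

section
/- Let F be a field of characteristic 0 and f : ℝ² → F² a unit-distance preserving map. If A, B, C, D ∈ ℝ², r is a rational number, and D − C = r·(B − A), then f(D) − f(C) = r·(f(B) − f(A)), where r acts on F² via the canonical embedding ℚ → F (Theorem 7; the case r = 1 is Theorem 6). -/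
namespace UD

def Q {F : Type*} [Field F] (v : F × F) : F := v.1 ^ 2 + v.2 ^ 2

theorem perp_zero {F : Type*} [Field F] {D a : F × F} (ha : Q a ≠ 0)
    (h1 : D.1 * a.1 + D.2 * a.2 = 0) (h2 : D.1 * a.2 - D.2 * a.1 = 0) : D = 0 := by
  unfold Q at ha
  ext
  · have : D.1 * (a.1 ^ 2 + a.2 ^ 2) = 0 := by linear_combination a.1 * h1 + a.2 * h2
    simpa [ha] using this
  · have : D.2 * (a.1 ^ 2 + a.2 ^ 2) = 0 := by linear_combination a.2 * h1 - a.1 * h2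
    simpa [ha] using this

theorem rhombus {F : Type*} [Field F] [CharZero F] {P S R T : F × F}
    (hRT : Q (R - T) ≠ 0) (h1 : Q (P - R) = 1) (h2 : Q (P - T) = 1)
    (h3 : Q (S - R) = 1) (h4 : Q (S - T) = 1) : P = S ∨ P + S = R + T := by
  have two : (2 : F) ≠ 0 := two_ne_zero
  have hD : (P - S).1 * (R - T).1 + (P - S).2 * (R - T).2 = 0 := by
    simp only [Q, Prod.fst_sub, Prod.snd_sub] at *
    apply mul_left_cancel₀ two
    linear_combination h2 - h1 - h4 + h3
  have hE : (P + S - (R + T)).1 * (R - T).1 + (P + S - (R + T)).2 * (R - T).2 = 0 := by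
    simp only [Q, Prod.fst_sub, Prod.snd_sub, Prod.fst_add, Prod.snd_add] at *
    apply mul_left_cancel₀ two
    linear_combination h2 - h1 + h4 - h3
  have hDE : (P - S).1 * (P + S - (R + T)).1 + (P - S).2 * (P + S - (R + T)).2 = 0 := by
    simp only [Q, Prod.fst_sub, Prod.snd_sub, Prod.fst_add, Prod.snd_add] at *
    apply mul_left_cancel₀ two
    linear_combination h1 + h2 - h3 - h4
  have hc : ((P - S).1 * (R - T).2 - (P - S).2 * (R - T).1) *
      ((P + S - (R + T)).1 * (R - T).2 - (P + S - (R + T)).2 * (R - T).1) = 0 := by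
    generalize P + S - (R + T) = E at *
    generalize P - S = D at *
    generalize R - T = a at *
    linear_combination (a.1 ^ 2 + a.2 ^ 2) * hDE - hD * (E.1 * a.1 + E.2 * a.2)
  rcases mul_eq_zero.1 hc with h | h
  · left; exact sub_eq_zero.1 (perp_zero hRT hD h)
  · right; exact sub_eq_zero.1 (perp_zero hRT hE h)

theorem normsq (a b : ℝ) : ‖(⟨a, b⟩ : ℂ)‖ ^ 2 = a ^ 2 + b ^ 2 := by
  rw [← Complex.normSq_eq_norm_sq, Complex.normSq_mk]; ring

noncomputable def om : ℂ := ⟨1 / 2, √3 / 2⟩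

theorem s3 : √3 ^ 2 = (3 : ℝ) := Real.sq_sqrt (by norm_num)

theorem norm_of_sq {z : ℂ} {r : ℝ} (hr : 0 ≤ r) (h : ‖z‖ ^ 2 = r ^ 2) : ‖z‖ = r :=
  (sq_eq_sq₀ (norm_nonneg _) hr).1 h

theorem om_norm : ‖om‖ = 1 := by
  apply norm_of_sq zero_le_one
  rw [om, normsq]; linear_combination s3 / 4

theorem om_sq : om ^ 2 = om - 1 := by
  apply Complex.ext <;> simp [om, pow_two]
  · linear_combination -s3 / 4
  · ring

theorem om_comb (a b : ℝ) : ‖(a : ℂ) + b * om‖ ^ 2 = a ^ 2 + a * b + b ^ 2 := by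
  have : (a : ℂ) + b * om = ⟨a + b / 2, b * √3 / 2⟩ := by
    apply Complex.ext <;> simp [om] <;> ring
  rw [this, normsq]; linear_combination b ^ 2 * s3 / 4

theorem tri (w : ℂ) (hw : w ≠ 0) (k : ℝ) : ∃ m : ℕ, ∃ z : ℂ,
    ‖z‖ = m + 1 ∧ ‖z - w‖ ^ 2 = ((m : ℝ) + 1) ^ 2 + k := by
  set d := ‖w‖ with hd
  have dpos : 0 < d := norm_pos_iff.2 hw
  obtain ⟨m, hm⟩ := exists_nat_ge (|d ^ 2 - k| / (2 * d))
  set r : ℝ := m + 1 with hr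
  have rpos : 0 < r := by positivity
  have h1 : |d ^ 2 - k| ≤ 2 * d * r := by
    rw [div_le_iff₀ (by positivity)] at hm
    rw [hr]; nlinarith
  have h2 : (d ^ 2 - k) ^ 2 ≤ (2 * d * r) ^ 2 := by
    rw [← sq_abs]; gcongr
  set α : ℝ := (d ^ 2 - k) / (2 * d ^ 2) with hα
  have hb : 0 ≤ r ^ 2 / d ^ 2 - α ^ 2 := by
    have : r ^ 2 / d ^ 2 - α ^ 2 = ((2 * d * r) ^ 2 - (d ^ 2 - k) ^ 2) / (4 * d ^ 4) := by
      rw [hα]; field_simp; ring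
    rw [this]; apply div_nonneg <;> [linarith; positivity]
  have hs := Real.sq_sqrt hb
  refine ⟨m, w * ⟨α, √(r ^ 2 / d ^ 2 - α ^ 2)⟩, ?_, ?_⟩
  · apply norm_of_sq rpos.le
    rw [norm_mul, mul_pow, normsq α, hs, ← hd]; field_simp; ring
  · have : w * ⟨α, √(r ^ 2 / d ^ 2 - α ^ 2)⟩ - w = w * ⟨α - 1, √(r ^ 2 / d ^ 2 - α ^ 2)⟩ := by
      have : (⟨α - 1, √(r ^ 2 / d ^ 2 - α ^ 2)⟩ : ℂ) = ⟨α, √(r ^ 2 / d ^ 2 - α ^ 2)⟩ - 1 := by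
        apply Complex.ext <;> simp
      rw [this]; ring
    rw [this, norm_mul, mul_pow, normsq (α - 1), hs, ← hd, hα]; field_simp; ring

section
variable {F : Type*} [Field F] [CharZero F] {f : ℂ → F × F}

def UP (f : ℂ → F × F) : Prop := ∀ x u : ℂ, ‖u‖ = 1 → Q (f (x + u) - f x) = 1

theorem Q_comm (a b : F × F) : Q (a - b) = Q (b - a) := by
  simp only [Q, Prod.fst_sub, Prod.snd_sub]; ring

theorem UP.sub (hf : UP f) (x y : ℂ) (h : ‖x - y‖ = 1) : Q (f x - f y) = 1 := by
  have := hf y (x - y) h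
  rwa [add_sub_cancel] at this

theorem om1 {u : ℂ} (hu : ‖u‖ = 1) : ‖om * u‖ = 1 := by rw [norm_mul, om_norm, hu, one_mul]

theorem om_sub : ‖om - 1‖ = 1 := by rw [← om_sq, norm_pow, om_norm, one_pow]

theorem pre (hf : UP f) (x u : ℂ) (hu : ‖u‖ = 1) :
    f x = f (x + u + om * u) ∨ f x + f (x + u + om * u) = f (x + u) + f (x + om * u) := by
  apply rhombus
  · rw [hf.sub]
    · exact one_ne_zero
    · rw [show x + u - (x + om * u) = -((om - 1) * u) by ring, norm_neg, norm_mul, om_sub, hu,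
        one_mul]
  · rw [Q_comm]; exact hf _ _ hu
  · rw [Q_comm]; exact hf _ _ (om1 hu)
  · exact hf _ _ (om1 hu)
  · rw [add_right_comm]; exact hf _ _ hu

theorem pre3 (hf : UP f) (x u : ℂ) (hu : ‖u‖ = 1) :
    f x = f (x + u + om * u) ∨ Q (f (x + u + om * u) - f x) = 3 := by
  refine (pre hf x u hu).imp_right fun h => ?_
  have h1 := hf x u hu
  have h2 := hf x _ (om1 hu)
  have h3 := hf.sub (x + u) (x + om * u) (by
    rw [show x + u - (x + om * u) = -((om - 1) * u) by ring, norm_neg, norm_mul, om_sub, hu,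
        one_mul])
  rw [eq_sub_of_add_eq' h]
  simp only [Q, Prod.fst_sub, Prod.snd_sub, Prod.fst_add, Prod.snd_add] at *
  linear_combination 2 * h1 + 2 * h2 - h3

theorem par (hf : UP f) (x u : ℂ) (hu : ‖u‖ = 1) :
    f x + f (x + u + om * u) = f (x + u) + f (x + om * u) := by
  rcases pre hf x u hu with h | h
  swap
  · exact h
  exfalso
  let ζ : ℂ := ⟨5 / 6, √11 / 6⟩
  have s11 : √11 ^ 2 = (11 : ℝ) := Real.sq_sqrt (by norm_num)
  have hζ : ‖ζ‖ = 1 := by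
    apply norm_of_sq zero_le_one
    rw [normsq]; linear_combination s11 / 36
  have hζ1 : ‖ζ - 1‖ ^ 2 = 1 / 3 := by
    have : ζ - 1 = ⟨-1 / 6, √11 / 6⟩ := by
      apply Complex.ext <;> simp [ζ]
      norm_num
    rw [this, normsq]; linear_combination s11 / 36
  have hw : ‖1 + om‖ ^ 2 = 3 := by
    have := om_comb 1 1
    norm_num at this; exact this
  have hu' : ‖ζ * u‖ = 1 := by rw [norm_mul, hζ, hu, one_mul]
  have h1 : Q (f (x + ζ * u + om * (ζ * u)) - f (x + u + om * u)) = 1 := by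
    apply hf.sub
    rw [show x + ζ * u + om * (ζ * u) - (x + u + om * u) = (ζ - 1) * (1 + om) * u by ring]
    apply norm_of_sq zero_le_one
    rw [norm_mul, norm_mul, hu, mul_pow, mul_pow, hζ1, hw]; norm_num
  rw [← h] at h1
  rcases pre3 hf x _ hu' with h2 | h2
  · rw [← h2] at h1; simp [Q] at h1
  · rw [h1] at h2; norm_num at h2

/-- the difference map -/
def g (f : ℂ → F × F) (u x : ℂ) : F × F := f (x + u) - f x

theorem g_om (hf : UP f) (x u : ℂ) (hu : ‖u‖ = 1) : g f u (x + om * u) = g f u x := by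
  have := par hf x u hu
  unfold g
  rw [add_right_comm x, sub_eq_sub_iff_add_eq_add, add_comm, this]

theorem g_self (hf : UP f) (x u : ℂ) (hu : ‖u‖ = 1) : g f u (x + u) = g f u x := by
  have hv : ‖(1 - om) * u‖ = 1 := by rw [norm_mul, norm_sub_rev, om_sub, hu, one_mul]
  have h1 := par hf (x + om * u) ((1 - om) * u) hv
  have e : om * ((1 - om) * u) = u := by linear_combination -u * om_sq
  rw [e] at h1
  rw [show x + om * u + (1 - om) * u = x + u by ring] at h1
  rw [← g_om hf x u hu]
  unfold g
  rw [sub_eq_sub_iff_add_eq_add, add_comm, h1, add_comm]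

theorem g_nat (hf : UP f) (x u : ℂ) (hu : ‖u‖ = 1) (n : ℕ) :
    g f u (x + n * u) = g f u x := by
  induction n with
  | zero => simp
  | succ n ih => 
    rw [← ih, ← g_self hf (x + n * u) u hu]; congr 1; push_cast; ring

theorem f_nat (hf : UP f) (x u : ℂ) (hu : ‖u‖ = 1) (n : ℕ) :
    f (x + n * u) = f x + (n : F) • g f u x := by
  induction n with
  | zero => simp
  | succ n ih =>
    have := g_nat hf x u hu n
    rw [g, sub_eq_iff_eq_add, ih] at this
    rw [show x + ((n + 1 : ℕ) : ℂ) * u = x + n * u + u by push_cast; ring, this]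
    push_cast; rw [add_smul, one_smul]; abel

theorem Q_nat (hf : UP f) (x z : ℂ) (m : ℕ) (hz : ‖z‖ = m + 1) :
    Q (f (x + z) - f x) = ((m : F) + 1) ^ 2 := by
  have hm : (m : ℂ) + 1 ≠ 0 := by exact_mod_cast Nat.succ_ne_zero m
  have hu : ‖z / (m + 1)‖ = 1 := by
    rw [norm_div, hz]
    have : ‖(m : ℂ) + 1‖ = m + 1 := by exact_mod_cast Complex.norm_natCast (m + 1)
    rw [this]; exact div_self (by positivity)
  have h1 := f_nat hf x _ hu (m + 1)
  have h2 := hf x _ hu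
  rw [show x + ((m + 1 : ℕ) : ℂ) * (z / (m + 1)) = x + z by push_cast; field_simp] at h1
  rw [h1]
  change Q (g f _ x) = 1 at h2
  simp only [Q, Prod.fst_sub, Prod.snd_sub, Prod.fst_add, Prod.snd_add, Prod.smul_fst,
    Prod.smul_snd, smul_eq_mul] at *
  push_cast
  linear_combination ((m : F) + 1) ^ 2 * h2

theorem Q_nat3 (hf : UP f) (x z : ℂ) (m : ℕ) (hz : ‖z‖ ^ 2 = ((m : ℝ) + 1) ^ 2 + 3) :
    Q (f (x + z) - f x) = ((m : F) + 1) ^ 2 + 3 := by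
  have hc : ‖(m : ℂ) + 2 * om‖ ^ 2 = ((m : ℝ) + 1) ^ 2 + 3 := by
    have := om_comb m 2
    push_cast at this; rw [this]; ring
  have hp : (0 : ℝ) < ((m : ℝ) + 1) ^ 2 + 3 := by positivity
  have hc0 : (m : ℂ) + 2 * om ≠ 0 := by
    intro h; rw [h] at hc; simp at hc; linarith
  obtain ⟨u, hu⟩ : ∃ u, z = ((m : ℂ) + 2 * om) * u := ⟨z / (m + 2 * om), by field_simp⟩
  have hu1 : ‖u‖ = 1 := by
    apply norm_of_sq zero_le_one
    rw [hu, norm_mul, mul_pow, hc] at hz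
    have := mul_left_cancel₀ hp.ne' (hz.trans (mul_one _).symm)
    rw [this]; norm_num
  have h1 := f_nat hf (x + 2 * (om * u)) u hu1 m
  have h2 := f_nat hf x _ (om1 hu1) 2
  have h3 : g f u (x + 2 * (om * u)) = g f u x := by
    rw [← g_om hf x u hu1, ← g_om hf (x + om * u) u hu1]; congr 1; ring
  push_cast at h2
  rw [h2, h3] at h1
  rw [show x + z = x + 2 * (om * u) + m * u by rw [hu]; ring, h1]
  have k1 := hf x u hu1
  have k2 := hf x _ (om1 hu1)
  have k3 := hf.sub (x + u) (x + om * u) (by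
    rw [show x + u - (x + om * u) = -((om - 1) * u) by ring, norm_neg, norm_mul, om_sub, hu1,
        one_mul])
  simp only [g, Q, Prod.fst_sub, Prod.snd_sub, Prod.fst_add, Prod.snd_add, Prod.smul_fst,
    Prod.smul_snd, smul_eq_mul] at *
  linear_combination ((m : F) ^ 2 + 2 * m) * k1 + (4 + 2 * (m : F)) * k2 - 2 * (m : F) * k3

theorem inj (hf : UP f) {x y : ℂ} (h : y ≠ x) : f y ≠ f x := by
  intro hxy
  obtain ⟨m, z, h1, h2⟩ := tri (y - x) (sub_ne_zero.2 h) 3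
  have k1 := Q_nat hf x z m h1
  have k2 := Q_nat3 hf y _ m h2
  rw [show y + (z - (y - x)) = x + z by ring, hxy, k1] at k2
  have : (3 : F) = 0 := by linear_combination -k2
  norm_num at this

theorem Q_ne (hf : UP f) {x y : ℂ} (h : y ≠ x) : Q (f y - f x) ≠ 0 := by
  intro h0
  obtain ⟨m, z, h1, h2⟩ := tri (y - x) (sub_ne_zero.2 h) 0
  have k1 := Q_nat hf x z m h1
  have k2 := Q_nat hf y _ m (norm_of_sq (by positivity) (h2.trans (add_zero _)))
  rw [show y + (z - (y - x)) = x + z by ring] at k2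
  have hm : (m : F) + 1 ≠ 0 := by exact_mod_cast Nat.succ_ne_zero m
  have hz : Q (f (x + z) - f x) ≠ 0 := by rw [k1]; exact pow_ne_zero _ hm
  refine inj hf h (sub_eq_zero.1 (perp_zero hz ?_ ?_))
  · simp only [Q, Prod.fst_sub, Prod.snd_sub] at *
    apply mul_left_cancel₀ (two_ne_zero (α := F))
    linear_combination k1 - k2 + h0
  · have e : (f y - f x).1 * (f (x + z) - f x).1 + (f y - f x).2 * (f (x + z) - f x).2 = 0 := by
      simp only [Q, Prod.fst_sub, Prod.snd_sub] at *
      apply mul_left_cancel₀ (two_ne_zero (α := F))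
      linear_combination k1 - k2 + h0
    have h0' := h0
    unfold Q at h0'
    generalize f y - f x = a at *
    generalize f (x + z) - f x = b at *
    apply pow_eq_zero_iff (two_ne_zero) |>.1
    linear_combination (b.1 ^ 2 + b.2 ^ 2) * h0' - (a.1 * b.1 + a.2 * b.2) * e

theorem g_unit (hf : UP f) (x u v : ℂ) (hu : ‖u‖ = 1) (hv : ‖v‖ = 1) :
    g f u (x + v) = g f u x := by
  by_cases h1 : u = v
  · rw [← h1]; exact g_self hf x u hu
  by_cases h2 : u = -v
  · have := g_self hf (x + v) u hu
    rw [← this]; congr 1; rw [h2]; ring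
  have key := rhombus (P := f x) (S := f (x + u + v)) (R := f (x + u)) (T := f (x + v))
    (Q_ne hf (by simpa using h1)) (by rw [Q_comm]; exact hf _ _ hu)
    (by rw [Q_comm]; exact hf _ _ hv) (hf _ _ hv) (by rw [add_right_comm]; exact hf _ _ hu)
  rcases key with h | h
  · exact absurd h.symm (inj hf (fun e => h2 (by linear_combination e)))
  · unfold g
    rw [add_right_comm x, sub_eq_sub_iff_add_eq_add, add_comm, h]

theorem decomp (w : ℂ) (hw : w ≠ 0) : ∃ n : ℕ, ∃ u v : ℂ, ‖u‖ = 1 ∧ ‖v‖ = 1 ∧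
    w = n * u + n * v := by
  obtain ⟨m, z, h1, h2⟩ := tri w hw 0
  have h3 := norm_of_sq (r := (m : ℝ) + 1) (by positivity) (h2.trans (add_zero _))
  have hm : (m : ℂ) + 1 ≠ 0 := by exact_mod_cast Nat.succ_ne_zero m
  have hn : ‖(m : ℂ) + 1‖ = m + 1 := by exact_mod_cast Complex.norm_natCast (m + 1)
  have hp : (m : ℝ) + 1 ≠ 0 := by positivity
  refine ⟨m + 1, z / (m + 1), (w - z) / (m + 1), ?_, ?_, ?_⟩
  · rw [norm_div, h1, hn, div_self hp]
  · rw [norm_div, norm_sub_rev, h3, hn, div_self hp]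
  · push_cast; field_simp; ring

theorem g_unit_nat (hf : UP f) (x u v : ℂ) (hu : ‖u‖ = 1) (hv : ‖v‖ = 1) (n : ℕ) :
    g f u (x + n * v) = g f u x := by
  induction n with
  | zero => simp
  | succ n ih =>
    rw [← ih, ← g_unit hf (x + n * v) u v hu hv]; congr 1; push_cast; ring

theorem g_const (hf : UP f) (x u : ℂ) (hu : ‖u‖ = 1) : g f u x = g f u 0 := by
  by_cases hx : x = 0
  · rw [hx]
  obtain ⟨n, a, b, ha, hb, rfl⟩ := decomp x hx
  rw [g_unit_nat hf _ _ _ hu hb, ← zero_add ((n : ℂ) * a), g_unit_nat hf _ _ _ hu ha]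

theorem add_map (hf : UP f) (x w : ℂ) : f (x + w) - f x = f w - f 0 := by
  by_cases hw : w = 0
  · simp [hw]
  obtain ⟨n, a, b, ha, hb, rfl⟩ := decomp w hw
  have key : ∀ y, f (y + (n * a + n * b)) = f y + (n : F) • g f a 0 + (n : F) • g f b 0 := by
    intro y
    rw [← add_assoc, f_nat hf _ b hb, f_nat hf y a ha, g_const hf _ b hb, g_const hf y a ha]
  have k0 := key 0
  rw [zero_add] at k0
  rw [key x, k0]; abel

theorem main (hf : UP f) (A B C D : ℂ) (r : ℚ) (h : D - C = (r : ℝ) • (B - A)) :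
    f D - f C = (r : F) • (f B - f A) := by
  let L : ℂ →+ F × F := ⟨⟨fun w => f w - f 0, by simp⟩, fun x y => by
    have := add_map hf x y
    change f (x + y) - f 0 = f x - f 0 + (f y - f 0)
    rw [← this]; abel⟩
  have hL : ∀ x y, f x - f y = L (x - y) := fun x y => by
    have := add_map hf y (x - y)
    rw [add_sub_cancel] at this; exact this
  rw [hL, hL, h]
  exact map_ratCast_smul L ℝ F r (B - A)

end
end UD

/-- **Theorem 7.** If `A, B, C, D ∈ ℝ²`, `r ∈ ℚ`, `D - C = r·(B - A)` and
`f : ℝ² → F²` preserves unit distance, then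
`f D - f C = r·(f B - f A)`, where `r` acts on `F²` via the canonical
embedding `ℚ → F`. -/
theorem stmt_16 (F : Type*) [Field F] [CharZero F]
    (f : EuclideanSpace ℝ (Fin 2) → (Fin 2 → F))
    (hf : ∀ x y : EuclideanSpace ℝ (Fin 2), dist x y = 1 →
      ∑ i, (f x i - f y i) ^ 2 = 1)
    (A B C D : EuclideanSpace ℝ (Fin 2)) (r : ℚ)
    (h : D - C = (r : ℝ) • (B - A)) :
    f D - f C = (r : F) • (f B - f A) := by
  let e := Complex.orthonormalBasisOneI.repr
  have key := UD.main (F := F) (f := fun z => (f (e z) 0, f (e z) 1)) (by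
    intro x u hu
    have := hf (e (x + u)) (e x) (by rw [e.dist_map, dist_eq_norm, add_sub_cancel_left, hu])
    rw [Fin.sum_univ_two] at this
    exact this) (e.symm A) (e.symm B) (e.symm C) (e.symm D) r (by
      rw [← map_sub, h, map_smul, map_sub])
  simp only [LinearIsometryEquiv.apply_symm_apply] at key
  have k1 := congrArg Prod.fst key
  have k2 := congrArg Prod.snd key
  funext i
  fin_cases i
  · exact k1
  · exact k2
end

section
/- Let F be a field of characteristic 0 and f : ℝ² → F² a unit-distance preserving map. If A, B, C, D ∈ ℝ² and the vectors B − A and D − C are linearly dependent over ℝ, then the vectors f(B) − f(A) and f(D) − f(C) are linearly dependent over F (Theorem 8). In particular, f maps collinear points of ℝ² to collinear points of F² (Corollary 2). -/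
open Complex in
/-- Triangle with prescribed sides. -/
lemma aux_tri (w : ℂ) (hw : w ≠ 0) (r s : ℝ) (hr : 0 ≤ r) (hs : 0 ≤ s)
    (h : (r^2 - s^2 + ‖w‖^2)^2 ≤ 4 * r^2 * ‖w‖^2) : ∃ z : ℂ, ‖z‖ = r ∧ ‖z - w‖ = s := by
  have hd : 0 < ‖w‖^2 := by positivity
  set d := ‖w‖^2 with hdd
  set a : ℝ := (r^2 - s^2 + d) / (2*d) with ha
  have ha2 : 2 * a * d = r^2 - s^2 + d := by rw [ha]; field_simp
  have hb : 0 ≤ r^2/d - a^2 := by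
    have : a^2 ≤ r^2/d := by
      rw [le_div_iff₀ hd]
      have h1 : (2*a*d)^2 ≤ 4*r^2*d := by rw [ha2]; exact h
      nlinarith
    linarith
  set b := √(r^2/d - a^2) with hbb
  have hb2 : b^2 = r^2/d - a^2 := Real.sq_sqrt hb
  have hb3 : (a^2 + b^2)*d = r^2 := by rw [hb2]; field_simp; ring
  refine ⟨w * (⟨a, b⟩ : ℂ), ?_, ?_⟩
  · have : ‖w * (⟨a, b⟩ : ℂ)‖^2 = r^2 := by
      rw [norm_mul, mul_pow, ← hdd, Complex.sq_norm, Complex.normSq_mk]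
      linarith
    exact (sq_eq_sq₀ (norm_nonneg _) hr).1 this
  · have : ‖w * (⟨a, b⟩ : ℂ) - w‖^2 = s^2 := by
      have e : w * (⟨a, b⟩ : ℂ) - w = w * (⟨a - 1, b⟩ : ℂ) := by
        have : (⟨a - 1, b⟩ : ℂ) = (⟨a, b⟩ : ℂ) - 1 := by
          apply Complex.ext <;> simp
        rw [this]; ring
      rw [e, norm_mul, mul_pow, ← hdd, Complex.sq_norm, Complex.normSq_mk]
      linear_combination hb3 - ha2
    exact (sq_eq_sq₀ (norm_nonneg _) hs).1 this

/-- The quadratic form. -/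
def qF {F : Type*} [Field F] (v : Fin 2 → F) : F := v 0 ^ 2 + v 1 ^ 2

lemma aux_perp {F : Type*} [Field F] (m p s : Fin 2 → F) (hm : m ≠ 0)
    (hp : p 0 * m 0 + p 1 * m 1 = 0) (hs : s 0 * m 0 + s 1 * m 1 = 0) :
    p 0 * s 1 - p 1 * s 0 = 0 := by
  have : m 0 ≠ 0 ∨ m 1 ≠ 0 := by
    by_contra! hh
    exact hm (by ext i; fin_cases i <;> simp [hh.1, hh.2])
  rcases this with h | h
  · apply mul_left_cancel₀ h
    linear_combination s 1 * hp - p 1 * hs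
  · apply mul_left_cancel₀ h
    linear_combination p 0 * hs - s 0 * hp

/-- Rhombi. -/
lemma aux_rhombus {F : Type*} [Field F] [CharZero F] (u v w : Fin 2 → F)
    (hu : qF u = 1) (hv : qF v = 1) (hwu : qF (w - u) = 1) (hwv : qF (w - v) = 1)
    (hw : w ≠ 0) (huv : u ≠ v) : w = u + v := by
  simp only [qF, Pi.sub_apply] at *
  have hd : u - v ≠ 0 := sub_ne_zero.2 huv
  have h2 : (2 : F) ≠ 0 := two_ne_zero
  have e1 : w 0 ^2 + w 1 ^2 = 2 * (w 0 * u 0 + w 1 * u 1) := by linear_combination hwu - hu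
  have e2 : w 0 ^2 + w 1 ^2 = 2 * (w 0 * v 0 + w 1 * v 1) := by linear_combination hwv - hv
  have k1 : w 0 * (u - v) 0 + w 1 * (u - v) 1 = 0 := by
    apply mul_left_cancel₀ h2; simp only [Pi.sub_apply]; linear_combination e2 - e1
  have k2 : (u + v) 0 * (u - v) 0 + (u + v) 1 * (u - v) 1 = 0 := by
    simp only [Pi.sub_apply, Pi.add_apply]; linear_combination hu - hv
  have k3 := aux_perp _ _ _ hd k1 k2
  have k4 : (w - (u + v)) 0 * (u - v) 0 + (w - (u + v)) 1 * (u - v) 1 = 0 := by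
    simp only [Pi.sub_apply, Pi.add_apply] at *; linear_combination k1 - k2
  by_contra hne
  have hy : w - (u + v) ≠ 0 := sub_ne_zero.2 hne
  have k5 : w 0 * (w - (u + v)) 0 + w 1 * (w - (u + v)) 1 = 0 := by
    apply mul_left_cancel₀ h2; simp only [Pi.sub_apply, Pi.add_apply]; linear_combination e1 + e2
  have kfive : (u - v) 0 * (w - (u + v)) 0 + (u - v) 1 * (w - (u + v)) 1 = 0 := by
    linear_combination k4
  have k6 := aux_perp _ _ _ hy k5 kfive
  have hiso : (u - v) 0 ^ 2 + (u - v) 1 ^ 2 = 0 := by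
    have : w 0 ≠ 0 ∨ w 1 ≠ 0 := by
      by_contra! hh
      exact hw (by ext i; fin_cases i <;> simp [hh.1, hh.2])
    rcases this with h | h
    · apply mul_left_cancel₀ h
      linear_combination (u - v) 0 * k1 + (u - v) 1 * k6
    · apply mul_left_cancel₀ h
      linear_combination (u - v) 1 * k1 - (u - v) 0 * k6
  simp only [Pi.sub_apply] at hiso
  have i1 : u 0 * v 0 + u 1 * v 1 = 1 := by
    apply mul_left_cancel₀ h2; linear_combination hu + hv - hiso
  have i2 : (u 0 * v 1 - u 1 * v 0) = 0 := by
    have : (u 0 * v 1 - u 1 * v 0)^2 = 0 := by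
      linear_combination (v 0 ^2 + v 1 ^2) * hu + hv - (u 0 * v 0 + u 1 * v 1 + 1) * i1
    exact pow_eq_zero_iff (two_ne_zero) |>.1 this
  apply huv
  ext i
  fin_cases i
  · show u 0 = v 0
    linear_combination v 0 * hu - u 0 * i1 + u 1 * i2
  · show u 1 = v 1
    linear_combination v 1 * hu - u 1 * i1 - u 0 * i2

lemma aux_sqrt3 : (√3 : ℝ)^2 = 3 := Real.sq_sqrt (by norm_num)

section
variable {F : Type*} [Field F] [CharZero F] (f : ℂ → (Fin 2 → F))

lemma aux_three_or (hf : ∀ x y : ℂ, ‖x - y‖ = 1 → qF (f x - f y) = 1) (x y : ℂ)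
    (h : ‖x - y‖^2 = 3) : f x = f y ∨ qF (f x - f y) = 3 := by
  have hw : y - x ≠ 0 := by
    intro h0
    have : x - y = 0 := by rw [← neg_sub, h0, neg_zero]
    rw [this] at h; simp at h
  have h' : ‖y - x‖^2 = 3 := by rw [norm_sub_rev]; exact h
  obtain ⟨z, hz1, hz2⟩ := aux_tri (y - x) hw 1 1 zero_le_one zero_le_one (by rw [h']; norm_num)
  by_cases hxy : f x = f y
  · exact Or.inl hxy
  right
  have hpl : ‖(z + (z - (y - x)))‖ ^2 = 1 := by
    have := parallelogram_law_with_norm ℝ z (z - (y - x))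
    rw [hz1, hz2] at this
    have e : z - (z - (y - x)) = y - x := by ring
    rw [e] at this
    nlinarith
  have hpl' : ‖(z + (z - (y - x)))‖ = 1 := by
    rw [← sq_eq_sq₀ (norm_nonneg _) zero_le_one, hpl]; norm_num
  have a1 := hf (x + z) x (by simpa using hz1)
  have a2 := hf (y - z) x (by rw [← hz2, norm_sub_rev (y - z) x]; congr 1; ring)
  have a3 := hf y (x + z) (by rw [← hz2, norm_sub_rev y (x + z)]; congr 1; ring)
  have a4 := hf y (y - z) (by simpa using hz1)
  have a5 := hf (x + z) (y - z) (by convert hpl' using 2; ring)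
  have r := aux_rhombus (f (x + z) - f x) (f (y - z) - f x) (f y - f x) a1 a2
    (by convert a3 using 2; abel) (by convert a4 using 2; abel)
    (sub_ne_zero.2 (Ne.symm hxy)) (by
      intro h0
      have : f (x + z) - f (y - z) = 0 := by
        have := sub_left_injective h0
        rw [this, sub_self]
      rw [this] at a5; simp [qF] at a5)
  have r0 := congrFun r 0
  have r1 := congrFun r 1
  simp only [qF, Pi.sub_apply, Pi.add_apply] at *
  have e0 : f y 0 = f (x+z) 0 + f (y - z) 0 - f x 0 := by linear_combination r0
  have e1 : f y 1 = f (x+z) 1 + f (y - z) 1 - f x 1 := by linear_combination r1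
  rw [e0, e1]
  linear_combination 2 * a1 + 2 * a2 - a5

lemma aux_three (hf : ∀ x y : ℂ, ‖x - y‖ = 1 → qF (f x - f y) = 1) (x y : ℂ)
    (h : ‖x - y‖^2 = 3) : qF (f x - f y) = 3 := by
  rcases aux_three_or f hf x y h with hxy | h3
  swap
  · exact h3
  exfalso
  have hw : y - x ≠ 0 := by
    intro h0
    have : x - y = 0 := by rw [← neg_sub, h0, neg_zero]
    rw [this] at h; simp at h
  have h' : ‖y - x‖^2 = 3 := by rw [norm_sub_rev]; exact h
  obtain ⟨z, hz1, hz2⟩ := aux_tri (y - x) hw (√3) 1 (by positivity) zero_le_one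
    (by rw [h', aux_sqrt3]; norm_num)
  have b1 := hf (x + z) y (by convert hz2 using 2; ring)
  have b2 := aux_three_or f hf (x + z) x (by simp [hz1])
  rw [← hxy] at b1
  rcases b2 with b2 | b2
  · rw [b2] at b1; simp [qF] at b1
  · rw [b2] at b1; norm_num at b1

lemma aux_ne (hf : ∀ x y : ℂ, ‖x - y‖ = 1 → qF (f x - f y) = 1) (x y : ℂ)
    (h1 : 1 ≤ ‖x - y‖^2) (h3 : ‖x - y‖^2 ≤ 3) : f x ≠ f y := by
  intro hxy
  have hw : y - x ≠ 0 := by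
    intro h0
    have : x - y = 0 := by rw [← neg_sub, h0, neg_zero]
    rw [this] at h1; norm_num at h1
  rw [norm_sub_rev] at h1 h3
  obtain ⟨z, hz1, hz2⟩ := aux_tri (y - x) hw 1 (√3) zero_le_one (by positivity)
    (by rw [aux_sqrt3]; nlinarith)
  have b1 := hf (x + z) x (by simpa using hz1)
  have b2 := aux_three f hf (x + z) y (by
    have e : x + z - y = z - (y - x) := by ring
    rw [e, hz2, aux_sqrt3])
  rw [← hxy, b1] at b2
  norm_num at b2

lemma aux_para (hf : ∀ x y : ℂ, ‖x - y‖ = 1 → qF (f x - f y) = 1) (A u v : ℂ)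
    (hu : ‖u‖ = 1) (hv : ‖v‖ = 1)
    (h1 : 1 ≤ ‖u - v‖^2) (h3 : ‖u - v‖^2 ≤ 3) :
    f (A + v + u) - f (A + v) = f (A + u) - f A := by
  have hpl := parallelogram_law_with_norm ℝ u v
  rw [hu, hv] at hpl
  have n1 := aux_ne f hf (A + v + u) A
    (by have e : A + v + u - A = u + v := by ring
        rw [e]; nlinarith) (by have e : A + v + u - A = u + v := by ring
                               rw [e]; nlinarith)
  have n2 := aux_ne f hf (A + u) (A + v)
    (by have e : A + u - (A + v) = u - v := by ring
        rw [e]; exact h1) (by have e : A + u - (A + v) = u - v := by ring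
                              rw [e]; exact h3)
  have a1 := hf (A + u) A (by simpa using hu)
  have a2 := hf (A + v) A (by simpa using hv)
  have a3 := hf (A + v + u) (A + u) (by convert hv using 2; ring)
  have a4 := hf (A + v + u) (A + v) (by convert hu using 2; ring)
  have r := aux_rhombus (f (A + u) - f A) (f (A + v) - f A) (f (A + v + u) - f A) a1 a2
    (by convert a3 using 2; abel) (by convert a4 using 2; abel)
    (sub_ne_zero.2 n1) (fun h0 => n2 (sub_left_injective h0))
  have : f (A + v + u) = f (A + u) - f A + (f (A + v) - f A) + f A := by rw [← r]; abel
  rw [this]; abel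

lemma aux_subgroup (K : AddSubgroup ℝ) (h : ∀ x : ℝ, 0 ≤ x → x ≤ 1/10 → x ∈ K) (x : ℝ) :
    x ∈ K := by
  have key : ∀ y : ℝ, 0 ≤ y → y ∈ K := by
    intro y hy
    obtain ⟨n, hn⟩ := exists_nat_gt (10 * y)
    have hn0 : (0:ℝ) < n := lt_of_le_of_lt (by positivity) hn
    have := K.nsmul_mem (h (y / n) (by positivity) (by
      rw [div_le_iff₀ hn0]; linarith)) n
    rw [nsmul_eq_mul] at this
    convert this using 1
    field_simp
  rcases le_total 0 x with hx | hx
  · exact key x hx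
  · have := K.neg_mem (key (-x) (by linarith))
    simpa using this

/-- translations which preserve the difference along `u`. -/
def auxT (f : ℂ → (Fin 2 → F)) (u : ℂ) : AddSubgroup ℂ where
  carrier := {w | ∀ A, f (A + w + u) - f (A + w) = f (A + u) - f A}
  zero_mem' := by intro A; simp
  add_mem' := by
    intro a b ha hb A
    have := hb (A + a)
    rw [← add_assoc, this]; exact ha A
  neg_mem' := by
    intro a ha A
    have := ha (A + -a)
    simp only [neg_add_cancel_right] at this
    exact this.symm

lemma auxT_top (hf : ∀ x y : ℂ, ‖x - y‖ = 1 → qF (f x - f y) = 1) (u : ℂ)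
    (hu : ‖u‖ = 1) (w : ℂ) : w ∈ auxT f u := by
  have base : ∀ c s : ℝ, c^2 + s^2 = 1 → |c| ≤ 1/2 → u * (⟨c, s⟩ : ℂ) ∈ auxT f u := by
    intro c s hcs hc A
    obtain ⟨hc1, hc2⟩ := abs_le.1 hc
    have e : ‖u - u * (⟨c, s⟩ : ℂ)‖^2 = 2 - 2 * c := by
      have : u - u * (⟨c, s⟩ : ℂ) = u * (⟨1 - c, -s⟩ : ℂ) := by
        have : (⟨1 - c, -s⟩ : ℂ) = 1 - (⟨c, s⟩ : ℂ) := by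
          apply Complex.ext <;> simp
        rw [this]; ring
      rw [this, norm_mul, hu, one_mul, Complex.sq_norm, Complex.normSq_mk]
      linear_combination hcs
    apply aux_para f hf A u _ hu
    · rw [norm_mul, hu, one_mul, ← sq_eq_sq₀ (norm_nonneg _) zero_le_one, Complex.sq_norm,
        Complex.normSq_mk]
      linear_combination hcs
    · rw [e]; linarith
    · rw [e]; linarith
  let φ : ℝ →+ ℂ :=
    { toFun := fun t => u * (⟨t, 0⟩ : ℂ)
      map_zero' := by
        have : (⟨0, 0⟩ : ℂ) = 0 := rfl
        rw [this, mul_zero]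
      map_add' := by
        intro a b
        have : (⟨a + b, 0⟩ : ℂ) = ⟨a, 0⟩ + ⟨b, 0⟩ := by apply Complex.ext <;> simp
        rw [this, mul_add] }
  let ψ : ℝ →+ ℂ :=
    { toFun := fun t => u * (⟨0, t⟩ : ℂ)
      map_zero' := by
        have : (⟨0, 0⟩ : ℂ) = 0 := rfl
        rw [this, mul_zero]
      map_add' := by
        intro a b
        have : (⟨0, a + b⟩ : ℂ) = ⟨0, a⟩ + ⟨0, b⟩ := by apply Complex.ext <;> simp
        rw [this, mul_add] }
  have hφ : ∀ a : ℝ, φ a ∈ auxT f u := by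
    intro a
    refine aux_subgroup ((auxT f u).comap φ) ?_ a
    intro x hx0 hx1
    have hq : (√(1 - (x/2)^2))^2 = 1 - (x/2)^2 := Real.sq_sqrt (by nlinarith)
    have b1 := base (x/2) (√(1 - (x/2)^2)) (by rw [hq]; ring)
      (by rw [abs_le]; constructor <;> linarith)
    have b2 := base (x/2) (-√(1 - (x/2)^2)) (by rw [neg_sq, hq]; ring)
      (by rw [abs_le]; constructor <;> linarith)
    have := (auxT f u).add_mem b1 b2
    rw [← mul_add] at this
    show u * (⟨x, 0⟩ : ℂ) ∈ auxT f u
    convert this using 2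
    apply Complex.ext <;> simp
  have hψ0 : ∀ c s : ℝ, c^2 + s^2 = 1 → |c| ≤ 1/2 → ψ s ∈ auxT f u := by
    intro c s h1 h2
    have := (auxT f u).sub_mem (base c s h1 h2) (hφ c)
    convert this using 1
    show u * (⟨0, s⟩ : ℂ) = u * (⟨c, s⟩ : ℂ) - u * (⟨c, 0⟩ : ℂ)
    rw [← mul_sub]
    congr 1
    apply Complex.ext <;> simp
  have hψ : ∀ a : ℝ, ψ a ∈ auxT f u := by
    intro a
    refine aux_subgroup ((auxT f u).comap ψ) ?_ a
    intro x hx0 hx1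
    have hq : (√(1 - (1-x)^2))^2 = 1 - (1-x)^2 := Real.sq_sqrt (by nlinarith)
    have b1 := hψ0 0 1 (by norm_num) (by norm_num)
    have b2 := hψ0 (√(1 - (1-x)^2)) (1 - x) (by rw [hq]; ring) (by
      rw [abs_of_nonneg (Real.sqrt_nonneg _)]
      apply Real.sqrt_le_iff.2
      constructor
      · norm_num
      · nlinarith)
    have := (auxT f u).sub_mem b1 b2
    rw [← map_sub] at this
    show ψ x ∈ auxT f u
    convert this using 2
    ring
  have hu0 : u ≠ 0 := by rintro rfl; simp at hu
  have := (auxT f u).add_mem (hφ (w / u).re) (hψ (w / u).im)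
  convert this using 1
  show w = u * (⟨(w / u).re, 0⟩ : ℂ) + u * (⟨0, (w / u).im⟩ : ℂ)
  rw [← mul_add]
  have : (⟨(w / u).re, 0⟩ : ℂ) + (⟨0, (w / u).im⟩ : ℂ) = w / u := by
    apply Complex.ext <;> simp
  rw [this]; field_simp

/-- good translations -/
def auxV (f : ℂ → (Fin 2 → F)) : AddSubgroup ℂ where
  carrier := {w | ∀ A, f (A + w) - f A = f w - f 0}
  zero_mem' := by intro A; simp
  add_mem' := by
    intro a b ha hb A
    have h1 := hb (A + a)
    have h2 := ha A
    have h3 := hb a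
    rw [← add_assoc]
    calc f (A + a + b) - f A = (f (A + a + b) - f (A + a)) + (f (A + a) - f A) := by abel
      _ = (f (a + b) - f a) + (f a - f 0) := by rw [h1, h2, h3]
      _ = _ := by abel
  neg_mem' := by
    intro a ha A
    have h1 := ha (A + -a)
    have h2 := ha (-a)
    simp only [neg_add_cancel_right, neg_add_cancel] at h1 h2
    rw [← neg_sub, h1, ← h2]; abel

lemma auxV_top (hf : ∀ x y : ℂ, ‖x - y‖ = 1 → qF (f x - f y) = 1) (w : ℂ) : w ∈ auxV f := by
  have hunit : ∀ u : ℂ, ‖u‖ = 1 → u ∈ auxV f := by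
    intro u hu A
    have := auxT_top f hf u hu A 0
    simpa using this
  by_cases hw : w = 0
  · rw [hw]; exact (auxV f).zero_mem
  obtain ⟨n, hn⟩ := exists_nat_gt ‖w‖
  have hn0 : (0:ℝ) < n := lt_of_le_of_lt (norm_nonneg _) hn
  have hnC : (n : ℂ) ≠ 0 := by
    intro h0
    have : n = 0 := by exact_mod_cast h0
    rw [this] at hn0; simp at hn0
  have hl : ‖w / n‖ ≤ 1 := by
    rw [norm_div, Complex.norm_natCast, div_le_one hn0]; exact hn.le
  obtain ⟨z, hz1, hz2⟩ := aux_tri (w / n) (div_ne_zero hw hnC) 1 1 zero_le_one zero_le_one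
    (by have := norm_nonneg (w / n)
        have h2 : ‖w / n‖^2 ≤ 1 := by nlinarith
        nlinarith [sq_nonneg ‖w / n‖])
  have := (auxV f).nsmul_mem ((auxV f).sub_mem (hunit z hz1) (hunit _ hz2)) n
  convert this using 1
  rw [nsmul_eq_mul]; field_simp; ring

lemma aux_hom (hf : ∀ x y : ℂ, ‖x - y‖ = 1 → qF (f x - f y) = 1) :
    ∃ h : ℂ →+ (Fin 2 → F), (∀ x y, f x - f y = h (x - y)) ∧ ∀ x, ‖x‖ = 1 → qF (h x) = 1 := by
  refine ⟨{ toFun := fun x => f x - f 0, map_zero' := by simp, map_add' := ?_ }, ?_, ?_⟩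
  · intro x y
    have := auxV_top f hf y x
    rw [← this]; abel
  · intro x y
    have := auxV_top f hf (x - y) y
    simpa using this
  · intro x hx
    exact hf x 0 (by simpa using hx)

lemma aux_nat (h : ℂ →+ (Fin 2 → F)) (hh : ∀ x, ‖x‖ = 1 → qF (h x) = 1) (n : ℕ) (x : ℂ)
    (hx : ‖x‖ = n) : qF (h x) = (n:F)^2 := by
  by_cases hn : n = 0
  · subst hn
    have : x = 0 := by simpa using hx
    subst this; simp [qF]
  have hnC : (n : ℂ) ≠ 0 := by exact_mod_cast hn
  have h1 : ‖x / n‖ = 1 := by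
    rw [norm_div, Complex.norm_natCast, hx]
    exact div_self (by exact_mod_cast hn)
  have h2 := hh _ h1
  have h3 : h x = n • h (x / n) := by
    rw [← map_nsmul, nsmul_eq_mul]; congr 1; field_simp
  rw [h3]
  simp only [qF, Pi.smul_apply, nsmul_eq_mul] at *
  linear_combination (n:F)^2 * h2

lemma aux_inj (h : ℂ →+ (Fin 2 → F)) (hh : ∀ x, ‖x‖ = 1 → qF (h x) = 1) (x : ℂ) (hx : x ≠ 0) :
    h x ≠ 0 := by
  intro h0
  have hx' : 0 < ‖x‖ := norm_pos_iff.2 hx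
  obtain ⟨k, hk⟩ := exists_nat_gt (1/‖x‖)
  have hk1 : 1 ≤ k * ‖x‖ := by
    rw [div_lt_iff₀ hx'] at hk; exact hk.le
  have hy0 : h (k • x) = 0 := by rw [map_nsmul, h0, smul_zero]
  have hyn : ‖k • x‖ = k * ‖x‖ := by rw [nsmul_eq_mul, norm_mul, Complex.norm_natCast]
  set y := k • x
  rw [← hyn] at hk1
  have hyne : y ≠ 0 := by
    intro h; rw [h] at hk1; norm_num at hk1
  obtain ⟨m, hm⟩ := exists_nat_gt ‖y‖
  have hm0 : (0:ℝ) < m := lt_of_le_of_lt (norm_nonneg _) hm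
  obtain ⟨z, hz1, hz2⟩ := aux_tri y hyne m ((m+1 : ℕ) : ℝ) (by positivity) (by positivity) (by
    push_cast
    have e : (m:ℝ)^2 - (m+1)^2 + ‖y‖^2 = ‖y‖^2 - 1 - 2*m := by ring
    rw [e]
    have h1 : -(2*m*‖y‖) ≤ ‖y‖^2 - 1 - 2*m := by nlinarith
    have h2 : ‖y‖^2 - 1 - 2*m ≤ 2*m*‖y‖ := by nlinarith
    have := sq_le_sq' h1 h2
    linarith)
  have c1 := aux_nat h hh m z hz1
  have c2 := aux_nat h hh (m+1) _ hz2
  rw [map_sub, hy0, sub_zero, c1] at c2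
  have : (m^2 : ℕ) = (m+1)^2 := by exact_mod_cast c2
  have h3 : m ^ 2 < (m + 1) ^ 2 := Nat.pow_lt_pow_left (Nat.lt_succ_self m) two_ne_zero
  omega

/-- Peaucellier inversor, for small `t`. -/
lemma aux_peau (h : ℂ →+ (Fin 2 → F)) (hh : ∀ x, ‖x‖ = 1 → qF (h x) = 1) (t : ℝ)
    (ht0 : 0 ≤ t) (ht1 : t ≤ 1/10) :
    h ⟨0, t⟩ 0 * h 1 0 + h ⟨0, t⟩ 1 * h 1 1 = 0 := by
  have hN : (0:ℝ) < 9 + t^2 := by positivity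
  obtain ⟨l, hl⟩ : ∃ l : ℝ, l * (9 + t^2) = 9 := ⟨9 / (9 + t^2), by field_simp⟩
  have hl1 : l ≤ 1 := by nlinarith
  have hl0 : 0 ≤ l := by nlinarith
  obtain ⟨m, hm, hm0⟩ : ∃ m : ℝ, m^2 * (9 + t^2) = 64 - (1-l)^2*(9+t^2) ∧ m ≠ 0 := by
    have hp : 0 < (64 - (1-l)^2*(9+t^2)) / (9 + t^2) := by
      apply div_pos _ hN
      have e1 : (1-l)*(9+t^2) = t^2 := by linear_combination -hl
      have e2 : (1-l)^2*(9+t^2) = (1-l) * t^2 := by linear_combination (1-l)*e1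
      rw [e2]
      nlinarith
    refine ⟨√((64 - (1-l)^2*(9+t^2)) / (9 + t^2)), ?_, (Real.sqrt_pos.2 hp).ne'⟩
    rw [Real.sq_sqrt hp.le]; field_simp
  set Q : ℂ := ⟨3, t⟩ with hQ
  set P : ℂ := ⟨l * 3, l * t⟩ with hP
  set n : ℂ := ⟨-(m * t), m * 3⟩ with hn
  have nrm : ∀ (k : ℕ) (z : ℂ), z.re^2 + z.im^2 = (k:ℝ)^2 → qF (h z) = (k:F)^2 := by
    intro k z hz
    apply aux_nat h hh
    rw [← sq_eq_sq₀ (norm_nonneg _) (by positivity), Complex.sq_norm, Complex.normSq_apply]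
    linear_combination hz
  have a1 := nrm 10 (P + Q + n) (by
    simp [hP, hQ, hn]; linear_combination hm + 4 * hl)
  have a2 := nrm 10 (P + Q - n) (by
    simp [hP, hQ, hn]; linear_combination hm + 4 * hl)
  have a3 := nrm 8 (P - Q + n) (by
    simp [hP, hQ, hn]; linear_combination hm)
  have a4 := nrm 8 (P - Q - n) (by
    simp [hP, hQ, hn]; linear_combination hm)
  have a5 := nrm 3 (P + P - (1 + 1 + 1)) (by
    simp [hP]; linear_combination 4 * l * hl)
  have a6 := hh 1 (by simp)
  have hne := aux_inj h hh n (by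
    intro h0
    have := congrArg Complex.im h0
    simp [hn] at this; exact hm0 this)
  have hsplit : h ⟨0, t⟩ = h Q - (h 1 + h 1 + h 1) := by
    rw [← map_add, ← map_add, ← map_sub]; congr 1
    apply Complex.ext
    · simp [hQ]; norm_num
    · simp [hQ]
  rw [hsplit]
  simp only [map_add, map_sub] at a1 a2 a3 a4 a5
  generalize h P = p at *
  generalize h Q = s at *
  generalize h n = y at *
  generalize h 1 = c at *
  simp only [qF, Pi.add_apply, Pi.sub_apply] at *
  push_cast at *
  have h8 : (8:F) ≠ 0 := by norm_num
  have c1 : p 0 * y 0 + p 1 * y 1 = 0 := by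
    apply mul_left_cancel₀ h8; linear_combination a1 - a2 + a3 - a4
  have c2 : s 0 * y 0 + s 1 * y 1 = 0 := by
    apply mul_left_cancel₀ h8; linear_combination a1 - a2 - a3 + a4
  have c3 : p 0 * s 0 + p 1 * s 1 = 9 := by
    apply mul_left_cancel₀ h8; linear_combination a1 + a2 - a3 - a4
  have c4 := aux_perp _ _ _ hne c1 c2
  have c5 : p 0 ^2 + p 1 ^2 = 3 * (p 0 * c 0 + p 1 * c 1) := by
    apply mul_left_cancel₀ (by norm_num : (4:F) ≠ 0)
    linear_combination a5 - 9 * a6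
  have c6 : s 0 * c 0 + s 1 * c 1 = 3 := by
    have hp : p 0 ≠ 0 ∨ p 1 ≠ 0 := by
      by_contra! hh
      rw [hh.1, hh.2] at c3; norm_num at c3
    have h3 : (3:F) ≠ 0 := by norm_num
    rcases hp with hp | hp
    · apply mul_left_cancel₀ hp
      apply mul_left_cancel₀ h3
      linear_combination (-s 0) * c5 + p 0 * c3 + (-p 1 + 3 * c 1) * c4
    · apply mul_left_cancel₀ hp
      apply mul_left_cancel₀ h3
      linear_combination (-s 1) * c5 + p 1 * c3 + (p 0 - 3 * c 0) * c4
  linear_combination c6 - 3 * a6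

lemma aux_orth (h : ℂ →+ (Fin 2 → F)) (hh : ∀ x, ‖x‖ = 1 → qF (h x) = 1) (t : ℝ) :
    h ⟨0, t⟩ 0 * h 1 0 + h ⟨0, t⟩ 1 * h 1 1 = 0 := by
  let K : AddSubgroup ℝ :=
    { carrier := {t | h ⟨0, t⟩ 0 * h 1 0 + h ⟨0, t⟩ 1 * h 1 1 = 0}
      zero_mem' := by
        have : (⟨0, 0⟩ : ℂ) = 0 := rfl
        simp [this]
      add_mem' := by
        intro a b ha hb
        have : (⟨0, a + b⟩ : ℂ) = ⟨0, a⟩ + ⟨0, b⟩ := by apply Complex.ext <;> simp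
        simp only [Set.mem_ofPred_eq, this, map_add, Pi.add_apply] at *
        linear_combination ha + hb
      neg_mem' := by
        intro a ha
        have : (⟨0, -a⟩ : ℂ) = -⟨0, a⟩ := by apply Complex.ext <;> simp
        simp only [Set.mem_ofPred_eq, this, map_neg, Pi.neg_apply] at *
        linear_combination -ha }
  exact aux_subgroup K (fun x h0 h1 => aux_peau h hh x h0 h1) t

lemma aux_main (h : ℂ →+ (Fin 2 → F)) (hh : ∀ x, ‖x‖ = 1 → qF (h x) = 1) (v : ℂ) (a b : ℝ) :
    h (a * v) 0 * h (b * v) 1 - h (a * v) 1 * h (b * v) 0 = 0 := by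
  by_cases hv : v = 0
  · simp [hv]
  have hv' : (‖v‖ : ℂ) ≠ 0 := by exact_mod_cast (norm_pos_iff.2 hv).ne'
  set c : ℂ := Complex.I * (v / ‖v‖) with hc
  have hcn : ‖c‖ = 1 := by
    rw [hc, norm_mul, norm_div]; simp [hv]
  have key : ∀ r : ℝ, h (r * v) 0 * h c 0 + h (r * v) 1 * h c 1 = 0 := by
    intro r
    have := aux_orth (h.comp (AddMonoidHom.mulLeft c)) (fun x hx => hh _ (by
      simp [hcn, hx])) (-(r * ‖v‖))
    simp only [AddMonoidHom.comp_apply, AddMonoidHom.coe_mulLeft, mul_one] at this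
    have e : c * (⟨0, -(r * ‖v‖)⟩ : ℂ) = r * v := by
      have : (⟨0, -(r * ‖v‖)⟩ : ℂ) = -(r * ‖v‖) * Complex.I := by
        apply Complex.ext <;> simp
      rw [this, hc]
      field_simp
      rw [Complex.I_sq]; ring
    rw [e] at this
    exact this
  exact aux_perp (h c) _ _ (aux_inj h hh c (by rintro h0; rw [h0] at hcn; simp at hcn))
    (key a) (key b)
end

lemma aux_dep {F : Type*} [Field F] (p q : Fin 2 → F) (h : p 0 * q 1 - p 1 * q 0 = 0) :
    ¬ LinearIndependent F ![p, q] := by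
  rw [LinearIndependent.pair_iff]
  intro H
  have h0 := H (q 0) (-p 0) (by
    ext i; fin_cases i
    · simp; ring
    · simp; linear_combination -h)
  have h1 := H (q 1) (-p 1) (by
    ext i; fin_cases i
    · simp; linear_combination h
    · simp; ring)
  have hp : p = 0 := by
    ext i; fin_cases i
    · simpa using h0.2
    · simpa using h1.2
  have := H 1 0 (by simp [hp])
  simp at this

lemma aux_plane (F : Type*) [Field F] [CharZero F]
    (f : EuclideanSpace ℝ (Fin 2) → (Fin 2 → F))
    (hf : ∀ x y : EuclideanSpace ℝ (Fin 2), dist x y = 1 →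
      ∑ i, (f x i - f y i) ^ 2 = 1)
    (A B C D v : EuclideanSpace ℝ (Fin 2)) (a b : ℝ) (h1 : B - A = a • v) (h2 : D - C = b • v) :
    (f B - f A) 0 * (f D - f C) 1 - (f B - f A) 1 * (f D - f C) 0 = 0 := by
  let g : ℂ → (Fin 2 → F) := fun z => f !₂[z.re, z.im]
  have hg : ∀ x y : ℂ, ‖x - y‖ = 1 → qF (g x - g y) = 1 := by
    intro x y hxy
    have := hf !₂[x.re, x.im] !₂[y.re, y.im] (by
      rw [EuclideanSpace.dist_eq, Fin.sum_univ_two]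
      simp only [Real.dist_eq, sq_abs]
      rw [← hxy, Complex.norm_def, Complex.normSq_apply]
      congr 1
      simp; ring)
    rw [Fin.sum_univ_two] at this
    exact this
  obtain ⟨h, hh1, hh2⟩ := aux_hom g hg
  have e : ∀ x : EuclideanSpace ℝ (Fin 2), f x = g ⟨x 0, x 1⟩ := by
    intro x
    show f x = f _
    congr 1
    ext i; fin_cases i <;> simp
  have e2 : ∀ (X Y : EuclideanSpace ℝ (Fin 2)) (r : ℝ), Y - X = r • v →
      f Y - f X = h (r * (⟨v 0, v 1⟩ : ℂ)) := by
    intro X Y r hr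
    rw [e, e, hh1]
    congr 1
    have t0 := congrArg (fun z : EuclideanSpace ℝ (Fin 2) => z 0) hr
    have t1 := congrArg (fun z : EuclideanSpace ℝ (Fin 2) => z 1) hr
    simp at t0 t1
    apply Complex.ext <;> simp [t0, t1]
  rw [e2 A B a h1, e2 C D b h2]
  exact aux_main h hh2 _ a b



/-- **Theorem 8 and Corollary 2.** If `f : ℝ² → F²` preserves unit distance,
then: (1) whenever the vectors `B - A` and `D - C` are linearly dependent
over `ℝ`, the vectors `f B - f A` and `f D - f C` are linearly dependent over
`F`; (2) `f` maps collinear points of `ℝ²` to collinear points of `F²`. -/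
theorem stmt_17 (F : Type*) [Field F] [CharZero F]
    (f : EuclideanSpace ℝ (Fin 2) → (Fin 2 → F))
    (hf : ∀ x y : EuclideanSpace ℝ (Fin 2), dist x y = 1 →
      ∑ i, (f x i - f y i) ^ 2 = 1) :
    (∀ A B C D : EuclideanSpace ℝ (Fin 2),
      ¬ LinearIndependent ℝ ![B - A, D - C] →
      ¬ LinearIndependent F ![f B - f A, f D - f C]) ∧
    (∀ p₁ p₂ p₃ : EuclideanSpace ℝ (Fin 2),
      Collinear ℝ ({p₁, p₂, p₃} : Set (EuclideanSpace ℝ (Fin 2))) →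
      Collinear F ({f p₁, f p₂, f p₃} : Set (Fin 2 → F))) := by
  constructor
  · intro A B C D hdep
    apply aux_dep
    rw [LinearIndependent.pair_iff] at hdep
    push Not at hdep
    obtain ⟨s, t, hst, hne⟩ := hdep
    by_cases hs : s = 0
    · have ht : t ≠ 0 := hne hs
      rw [hs, zero_smul, zero_add, smul_eq_zero] at hst
      have h0 : D - C = 0 := hst.resolve_left ht
      exact aux_plane F f hf A B C D (B - A) 1 0 (by simp) (by simp [h0])
    · refine aux_plane F f hf A B C D (D - C) (-(t/s)) 1 ?_ (by simp)
      have : s • (B - A) = -(t • (D - C)) := eq_neg_of_add_eq_zero_left hst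
      rw [neg_smul, div_eq_inv_mul, mul_smul, ← smul_neg, ← this, smul_smul,
        inv_mul_cancel₀ hs, one_smul]
  · intro p₁ p₂ p₃ hcol
    rw [collinear_iff_of_mem (p₀ := p₁) (by simp)] at hcol
    obtain ⟨v, hv⟩ := hcol
    obtain ⟨a, ha⟩ := hv p₂ (by simp)
    obtain ⟨b, hb⟩ := hv p₃ (by simp)
    have hdet := aux_plane F f hf p₁ p₂ p₁ p₃ v a b (by rw [ha]; simp) (by rw [hb]; simp)
    rw [collinear_iff_of_mem (p₀ := f p₁) (by simp)]
    have fin : ∀ d : Fin 2 → F, (∃ r : F, f p₂ - f p₁ = r • d) → (∃ r : F, f p₃ - f p₁ = r • d) →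
        ∃ d : Fin 2 → F, ∀ p ∈ ({f p₁, f p₂, f p₃} : Set (Fin 2 → F)),
          ∃ r : F, p = r • d +ᵥ f p₁ := by
      rintro d ⟨r, hr⟩ ⟨r', hr'⟩
      refine ⟨d, ?_⟩
      intro p hp
      simp only [Set.mem_insert_iff, Set.mem_singleton_iff] at hp
      rcases hp with rfl | rfl | rfl
      · exact ⟨0, by simp⟩
      · exact ⟨r, by rw [← hr]; simp⟩
      · exact ⟨r', by rw [← hr']; simp⟩
    generalize f p₂ - f p₁ = x at *
    generalize f p₃ - f p₁ = y at *
    by_cases hx0 : x 0 = 0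
    · by_cases hx1 : x 1 = 0
      · apply fin y ⟨0, _⟩ ⟨1, by simp⟩
        ext i; fin_cases i <;> simp [hx0, hx1]
      · apply fin x ⟨1, by simp⟩ ⟨y 1 / x 1, _⟩
        ext i; fin_cases i
        · simp; field_simp; linear_combination -hdet
        · simp; field_simp
    · apply fin x ⟨1, by simp⟩ ⟨y 0 / x 0, _⟩
      ext i; fin_cases i
      · simp; field_simp
      · simp; field_simp; linear_combination hdet
end

section
/- Let F be a field of characteristic 0 and f : ℝ² → F² a unit-distance preserving map. If P, Q, X, Y ∈ ℝ² and the vector Q − P is perpendicular to the vector Y − X (i.e., their standard dot product in ℝ² is 0), then (f(Q)₁ − f(P)₁)(f(Y)₁ − f(X)₁) + (f(Q)₂ − f(P)₂)(f(Y)₂ − f(X)₂) = 0 (Theorem 9). -/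
/-- dot product on pairs -/
def dt {F : Type*} [Field F] (a b : F × F) : F := a.1 * b.1 + a.2 * b.2

/-- squared norm on the plane -/
def nq (z : ℂ) : ℝ := z.re ^ 2 + z.im ^ 2

section algebra
variable {F : Type*} [Field F]

lemma dt_perp_par {w d s : F × F} (hw : w ≠ 0) (h1 : dt d w = 0) (h2 : dt s w = 0) :
    d.1 * s.2 = d.2 * s.1 := by
  obtain ⟨w1, w2⟩ := w
  obtain ⟨d1, d2⟩ := d
  obtain ⟨s1, s2⟩ := s
  simp only [dt, ne_eq, Prod.mk_eq_zero, not_and_or] at *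
  rcases hw with hw | hw
  · apply mul_left_cancel₀ hw
    linear_combination s2 * h1 - d2 * h2
  · apply mul_left_cancel₀ hw
    linear_combination (-s1) * h1 + d1 * h2

lemma dt_self_zero {w d : F × F} (hw : dt w w ≠ 0) (h1 : dt d w = 0)
    (h2 : d.1 * w.2 = d.2 * w.1) : d = 0 := by
  obtain ⟨w1, w2⟩ := w
  obtain ⟨d1, d2⟩ := d
  simp only [dt] at *
  ext
  · apply mul_left_cancel₀ hw
    simp only [Prod.fst_zero]
    linear_combination w1 * h1 + w2 * h2
  · apply mul_left_cancel₀ hw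
    simp only [Prod.snd_zero]
    linear_combination w2 * h1 - w1 * h2

/-- Rhombus lemma with a vertex at the origin. -/
lemma rhombus0 [CharZero F] {b c d : F × F} (hb : dt b b = 1) (hc : dt c c = 1)
    (hdb : dt (d - b) (d - b) = 1) (hdc : dt (d - c) (d - c) = 1) :
    d = 0 ∨ b = c ∨ d = b + c := by
  by_cases hbc : b = c
  · exact Or.inr (Or.inl hbc)
  have hw : b - c ≠ 0 := sub_ne_zero.mpr hbc
  have h2 : (2 : F) ≠ 0 := two_ne_zero
  have h1 : dt d (b - c) = 0 := by
    apply mul_left_cancel₀ h2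
    simp only [dt, Prod.fst_sub, Prod.snd_sub] at *
    linear_combination hdc - hdb + hb - hc
  have h3 : dt (d - (b + c)) (b - c) = 0 := by
    simp only [dt, Prod.fst_sub, Prod.snd_sub, Prod.fst_add, Prod.snd_add] at *
    linear_combination h1 - hb + hc
  have h4 : dt d (d - (b + c)) = 0 := by
    apply mul_left_cancel₀ h2
    simp only [dt, Prod.fst_sub, Prod.snd_sub, Prod.fst_add, Prod.snd_add] at *
    linear_combination hdc + hdb - hb - hc
  have hww : dt (b - c) (b - c) ≠ 0 := by
    intro h
    have hbc1 : dt b c = 1 := by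
      apply mul_left_cancel₀ h2
      simp only [dt, Prod.fst_sub, Prod.snd_sub] at *
      linear_combination hb + hc - h
    have hdet : b.1 * c.2 = b.2 * c.1 := by
      have : (b.1 * c.2 - b.2 * c.1) ^ 2 = 0 := by
        simp only [dt] at *
        linear_combination (c.1 * c.1 + c.2 * c.2) * hb + hc - (b.1 * c.1 + b.2 * c.2 + 1) * hbc1
      exact sub_eq_zero.mp (pow_eq_zero_iff (two_ne_zero) |>.mp this)
    apply hw
    apply dt_self_zero (w := b)
    · rw [hb]; exact one_ne_zero
    · simp only [dt, Prod.fst_sub, Prod.snd_sub] at *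
      linear_combination hb - hbc1
    · simp only [Prod.fst_sub, Prod.snd_sub]
      linear_combination hdet
  have hpar := dt_perp_par hw h1 h3
  by_cases hd : d = 0
  · exact Or.inl hd
  right; right
  rw [← sub_eq_zero]
  by_cases hdd : dt d d = 0
  · exfalso
    apply hd
    -- d is perpendicular to itself and to w
    have hp := dt_perp_par (w := d) (d := d) (s := b - c) hd hdd
      (by simp only [dt] at *; linear_combination h1)
    exact dt_self_zero hww h1 hp
  · apply dt_self_zero hdd
    · simp only [dt] at *; linear_combination h4
    · linear_combination -hpar

end algebra

section plane

lemma apex {z : ℂ} (hz : z ≠ 0) {R S : ℝ} (h1 : (R - S) ^ 2 ≤ nq z) (h2 : nq z ≤ (R + S) ^ 2) :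
    ∃ w : ℂ, nq w = R ^ 2 ∧ nq (w - z) = S ^ 2 := by
  have hn : 0 < nq z := by
    rcases (not_and_or.mp (fun h => hz (Complex.ext h.1 h.2)) : ¬ z.re = 0 ∨ ¬ z.im = 0) with h | h
    · have := sq_pos_of_ne_zero h
      unfold nq; nlinarith [sq_nonneg z.im]
    · have := sq_pos_of_ne_zero h
      unfold nq; nlinarith [sq_nonneg z.re]
  set n := nq z with hnd
  set c := (R ^ 2 - S ^ 2 + n) / (2 * n) with hc
  have hcn : 2 * (c * n) = R ^ 2 - S ^ 2 + n := by rw [hc]; field_simp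
  have hp : 0 ≤ R ^ 2 / n - c ^ 2 := by
    have : R ^ 2 / n - c ^ 2 = ((R + S) ^ 2 - n) * (n - (R - S) ^ 2) / (4 * n ^ 2) := by
      rw [hc]; field_simp; ring
    rw [this]
    apply div_nonneg (mul_nonneg (by linarith) (by linarith)) (by positivity)
  obtain ⟨s, hs⟩ : ∃ s : ℝ, s ^ 2 = R ^ 2 / n - c ^ 2 := ⟨_, Real.sq_sqrt hp⟩
  have hs' : (s ^ 2 + c ^ 2) * n = R ^ 2 := by rw [hs]; field_simp; ring
  refine ⟨⟨c * z.re - s * z.im, c * z.im + s * z.re⟩, ?_, ?_⟩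
  · have : n = z.re ^ 2 + z.im ^ 2 := hnd
    simp only [nq]
    rw [← hs', this]; ring
  · have : n = z.re ^ 2 + z.im ^ 2 := hnd
    simp only [nq, Complex.sub_re, Complex.sub_im]
    have e : (c * z.re - s * z.im - z.re) ^ 2 + (c * z.im + s * z.re - z.im) ^ 2
      = (s ^ 2 + c ^ 2) * n - 2 * (c * n) + n := by rw [this]; ring
    rw [e, hs', hcn]; ring

lemma units_top (G : AddSubgroup ℂ) (h : ∀ e, nq e = 1 → e ∈ G) : G = ⊤ := by
  rw [eq_top_iff]
  intro v _
  by_cases hv : v = 0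
  · rw [hv]; exact G.zero_mem
  obtain ⟨n, hn⟩ := exists_nat_gt (nq v)
  have hnv : 0 ≤ nq v := by unfold nq; positivity
  have hn0 : (0 : ℝ) < n := by linarith
  have hn1 : (1 : ℝ) ≤ n := by
    have : 0 < n := by exact_mod_cast hn0
    exact_mod_cast this
  set z : ℂ := ⟨v.re / n, v.im / n⟩ with hzd
  have hz : (n : ℕ) • z = v := by
    apply Complex.ext <;> simp [hzd] <;> field_simp
  have hz0 : z ≠ 0 := by rintro h0; rw [h0, smul_zero] at hz; exact hv hz.symm
  have hnz : nq z = nq v / n ^ 2 := by simp only [nq, hzd]; field_simp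
  obtain ⟨w, hw1, hw2⟩ := apex hz0 (R := 1) (S := 1) (by simp; unfold nq; positivity)
    (by rw [hnz, div_le_iff₀ (by positivity)]; nlinarith)
  have m1 := h w (by simpa using hw1)
  have m2 := h (w - z) (by simpa using hw2)
  have := G.nsmul_mem (G.sub_mem m1 m2) n
  rwa [sub_sub_cancel, hz] at this

end plane

section geom
variable {F : Type*} [Field F] [CharZero F]

/-- unit distance preservation -/
def UP (g : ℂ → F × F) : Prop :=
  ∀ p q : ℂ, nq (q - p) = 1 → dt (g q - g p) (g q - g p) = 1

lemma nq_neg (z : ℂ) : nq (-z) = nq z := by simp [nq]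

lemma UP.rh {g : ℂ → F × F} (H : UP g) (p e e' : ℂ) (he : nq e = 1) (he' : nq e' = 1) :
    g (p + e + e') = g p ∨ g (p + e) = g (p + e') ∨
      g (p + e + e') = g (p + e) + g (p + e') - g p := by
  have h1 := H p (p + e) (by simpa using he)
  have h2 := H p (p + e') (by simpa using he')
  have h3 := H (p + e) (p + e + e') (by simpa using he')
  have h4 := H (p + e') (p + e + e') (by
    have : p + e + e' - (p + e') = e := by ring
    rw [this]; exact he)
  rcases rhombus0 (d := g (p + e + e') - g p) h1 h2 (by simpa using h3) (by simpa using h4)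
    with h | h | h
  · left; exact sub_eq_zero.mp h
  · right; left; exact sub_left_injective h
  · right; right
    rw [sub_eq_iff_eq_add.mp h]; abel

/-- 60 degree rhombus, possibly degenerate -/
lemma UP.rh60 {g : ℂ → F × F} (H : UP g) (p e e' : ℂ) (he : nq e = 1) (he' : nq e' = 1)
    (hee : nq (e - e') = 1) :
    g (p + e + e') = g p ∨ g (p + e + e') = g (p + e) + g (p + e') - g p := by
  rcases H.rh p e e' he he' with h | h | h
  · exact Or.inl h
  · exfalso
    have := H (p + e') (p + e) (by simpa using hee)
    rw [h] at this
    simp [dt] at this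
  · exact Or.inr h

lemma UP.rt3 {g : ℂ → F × F} (H : UP g) (p v : ℂ) (hv : nq v = 3) :
    g (p + v) = g p ∨ dt (g (p + v) - g p) (g (p + v) - g p) = 3 := by
  have hs : (√3 : ℝ) ^ 2 = 3 := Real.sq_sqrt (by norm_num)
  set s : ℝ := √3 with hsd
  unfold nq at hv
  let e : ℂ := ⟨v.re / 2 - v.im * s / 6, v.im / 2 + v.re * s / 6⟩
  let e' : ℂ := ⟨v.re / 2 + v.im * s / 6, v.im / 2 - v.re * s / 6⟩
  have he : nq e = 1 := by
    simp only [nq, e]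
    linear_combination (1 / 4 + s ^ 2 / 36) * hv + 1 / 12 * hs
  have he' : nq e' = 1 := by
    simp only [nq, e']
    linear_combination (1 / 4 + s ^ 2 / 36) * hv + 1 / 12 * hs
  have hee : nq (e - e') = 1 := by
    simp only [nq, e, e', Complex.sub_re, Complex.sub_im]
    linear_combination (s ^ 2 / 9) * hv + 1 / 3 * hs
  have hsum : p + e + e' = p + v := by
    rw [add_assoc]; congr 1
    apply Complex.ext <;> simp [e, e'] <;> ring
  have h1 := H p (p + e) (by simpa using he)
  have h2 := H p (p + e') (by simpa using he')
  have h3 := H (p + e') (p + e) (by simpa using hee)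
  rcases H.rh60 p e e' he he' hee with h | h
  · left; rw [← hsum, h]
  · right; rw [← hsum, h]
    simp only [dt, Prod.fst_sub, Prod.snd_sub, Prod.fst_add, Prod.snd_add] at *
    linear_combination 2 * h1 + 2 * h2 - h3

lemma UP.rt3_ne {g : ℂ → F × F} (H : UP g) (p v : ℂ) (hv : nq v = 3) :
    g (p + v) ≠ g p := by
  intro h
  have hs : (√11 : ℝ) ^ 2 = 11 := Real.sq_sqrt (by norm_num)
  set s : ℝ := √11 with hsd
  have hv0 := hv
  unfold nq at hv
  let v' : ℂ := ⟨5 / 6 * v.re - s / 6 * v.im, 5 / 6 * v.im + s / 6 * v.re⟩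
  have hv' : nq v' = 3 := by
    simp only [nq, v']
    linear_combination (25 / 36 + s ^ 2 / 36) * hv + 1 / 12 * hs
  have hd : nq (v' - v) = 1 := by
    simp only [nq, v', Complex.sub_re, Complex.sub_im]
    linear_combination (1 / 36 + s ^ 2 / 36) * hv + 1 / 12 * hs
  have h1 := H (p + v) (p + v') (by simpa using hd)
  rw [h] at h1
  rcases H.rt3 p v' hv' with h2 | h2
  · rw [h2] at h1; simp [dt] at h1
  · rw [h2] at h1
    norm_num at h1

lemma UP.par60 {g : ℂ → F × F} (H : UP g) (p e e' : ℂ) (he : nq e = 1) (he' : nq e' = 1)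
    (hee : nq (e - e') = 1) :
    g (p + e + e') = g (p + e) + g (p + e') - g p := by
  rcases H.rh60 p e e' he he' hee with h | h
  · exfalso
    rw [add_assoc] at h
    refine H.rt3_ne p (e + e') ?_ h
    simp only [nq, Complex.sub_re, Complex.sub_im, Complex.add_re, Complex.add_im] at *
    linarith
  · exact h

lemma UP.double {g : ℂ → F × F} (H : UP g) (p e : ℂ) (he : nq e = 1) :
    g (p + e + e) = g (p + e) + g (p + e) - g p := by
  have hs : (√3 : ℝ) ^ 2 = 3 := Real.sq_sqrt (by norm_num)
  set s : ℝ := √3 with hsd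
  have he0 := he
  unfold nq at he
  let w : ℂ := ⟨e.re / 2 - s / 2 * e.im, e.im / 2 + s / 2 * e.re⟩
  have hw : nq w = 1 := by
    simp only [nq, w]
    linear_combination (1 / 4 + s ^ 2 / 4) * he + 1 / 4 * hs
  have hew : nq (e - w) = 1 := by
    simp only [nq, w, Complex.sub_re, Complex.sub_im]
    linear_combination (1 / 4 + s ^ 2 / 4) * he + 1 / 4 * hs
  have h1 := H.par60 p e w he0 hw hew
  have h2 := H.par60 (p + w) e (e - w) he0 hew (by simpa using hw)
  have e1 : p + w + e + (e - w) = p + e + e := by ring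
  have e2 : p + w + e = p + e + w := by ring
  have e3 : p + w + (e - w) = p + e := by ring
  rw [e1, e2, e3, h1] at h2
  rw [h2]; abel

lemma UP.line {g : ℂ → F × F} (H : UP g) (p e : ℂ) (he : nq e = 1) (n : ℕ) :
    g (p + n * e) = g p + n • (g (p + e) - g p) := by
  induction n using Nat.twoStepInduction with
  | zero => simp
  | one => simp
  | more n h1 h2 =>
    have h := H.double (p + n * e) e he
    have e1 : p + n * e + e + e = p + (n + 2 : ℕ) * e := by push_cast; ring
    have e2 : p + n * e + e = p + (n + 1 : ℕ) * e := by push_cast; ring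
    rw [e1, e2, h1, h2] at h
    rw [h]
    simp only [add_smul, one_smul, two_smul]; abel

lemma UP.intdist {g : ℂ → F × F} (H : UP g) (p v : ℂ) (n : ℕ) (hn : 0 < n)
    (hv : nq v = (n : ℝ) ^ 2) : dt (g (p + v) - g p) (g (p + v) - g p) = (n : F) ^ 2 := by
  have hn' : (n : ℝ) ≠ 0 := by positivity
  let e : ℂ := ⟨v.re / n, v.im / n⟩
  have he : nq e = 1 := by
    simp only [nq, e] at *
    field_simp; exact hv
  have hve : v = n * e := by
    apply Complex.ext <;> simp [e] <;> field_simp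
  have h1 := H p (p + e) (by simpa using he)
  rw [hve, H.line p e he]
  rw [add_sub_cancel_left]
  simp only [dt, Prod.smul_fst, Prod.smul_snd] at *
  simp only [nsmul_eq_mul] at *
  linear_combination (n : F) ^ 2 * h1

lemma UP.inj_large {g : ℂ → F × F} (H : UP g) (p v : ℂ) (hv : 1 ≤ nq v) : g (p + v) ≠ g p := by
  intro h
  obtain ⟨n, hn⟩ := exists_nat_gt (nq v)
  have hn0 : 0 < n := by
    have : (0 : ℝ) < n := by linarith
    exact_mod_cast this
  have hv0 : v ≠ 0 := by rintro rfl; norm_num [nq] at hv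
  obtain ⟨w, hw1, hw2⟩ := apex hv0 (R := n) (S := (n + 1 : ℕ)) (by push_cast; ring_nf; linarith)
    (by push_cast; nlinarith)
  have h1 := H.intdist p w n hn0 hw1
  have h2 := H.intdist (p + v) (w - v) (n + 1) (by omega) hw2
  rw [add_add_sub_cancel, h, h1] at h2
  have h3 : (n : F) ^ 2 = ((n + 1 : ℕ) : F) ^ 2 := h2
  have h4 : n ^ 2 = (n + 1) ^ 2 := by exact_mod_cast h3
  nlinarith

lemma UP.inj {g : ℂ → F × F} (H : UP g) (p v : ℂ) (hv : v ≠ 0) : g (p + v) ≠ g p := by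
  rcases le_total 1 (nq v) with h1 | h1
  · exact H.inj_large p v h1
  intro h
  obtain ⟨w, hw1, hw2⟩ := apex hv (R := 1) (S := 1) (by simp; unfold nq; positivity)
    (by linarith)
  -- center p + w
  have hp : 0 < nq v := by
    rcases (not_and_or.mp (fun h => hv (Complex.ext h.1 h.2)) : ¬ v.re = 0 ∨ ¬ v.im = 0) with h | h
    · have := sq_pos_of_ne_zero h
      unfold nq; nlinarith [sq_nonneg v.im]
    · have := sq_pos_of_ne_zero h
      unfold nq; nlinarith [sq_nonneg v.re]
  obtain ⟨n, hn⟩ := exists_nat_gt (1 / nq v)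
  rw [div_lt_iff₀ hp] at hn
  have hn1 : (1 : ℝ) ≤ n := by
    have : (0 : ℝ) < n := by by_contra hh; nlinarith
    have : 0 < n := by exact_mod_cast this
    exact_mod_cast this
  have a1 := H.line (p + w) (-w) (by rw [nq_neg]; simpa using hw1) n
  have a2 := H.line (p + w) (v - w) (by rw [← nq_neg]; simpa using hw2) n
  have e1 : p + w + -w = p := by ring
  have e2 : p + w + (v - w) = p + v := by ring
  rw [e1] at a1
  rw [e2, h, ← a1] at a2
  have e3 : p + w + n * (v - w) = p + w + n * (-w) + n * v := by ring
  rw [e3] at a2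
  refine H.inj_large _ _ ?_ a2
  have : nq (n * v) = n ^ 2 * nq v := by simp [nq]; ring
  rw [this]; nlinarith

lemma UP.par {g : ℂ → F × F} (H : UP g) (p e e' : ℂ) (he : nq e = 1) (he' : nq e' = 1) :
    g (p + e' + e) - g (p + e') = g (p + e) - g p := by
  by_cases h1 : e = e'
  · subst h1
    rw [H.double p e he]; abel
  by_cases h2 : e' + e = 0
  · have : e' = -e := eq_neg_of_add_eq_zero_left h2
    subst this
    have h3 := H.double (p + -e) e he
    rw [neg_add_cancel_right] at *
    rw [h3]; abel
  rcases H.rh p e' e he' he with h | h | h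
  · exfalso
    rw [add_assoc] at h
    exact H.inj p _ h2 h
  · exfalso
    have e1 : p + e = p + e' + (e - e') := by ring
    rw [e1] at h
    exact H.inj _ _ (sub_ne_zero.mpr h1) h.symm
  · rw [h]; abel

lemma UP.addunit {g : ℂ → F × F} (H : UP g) (e : ℂ) (he : nq e = 1) (t p : ℂ) :
    g (p + t + e) - g (p + t) = g (p + e) - g p := by
  let G : AddSubgroup ℂ :=
    { carrier := {t | ∀ p, g (p + t + e) - g (p + t) = g (p + e) - g p}
      zero_mem' := by intro p; simp
      add_mem' := by
        intro a b ha hb p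
        rw [← add_assoc, hb (p + a), ha p]
      neg_mem' := by
        intro a ha p
        have := ha (p + -a)
        rw [neg_add_cancel_right] at this
        exact this.symm }
  have : G = ⊤ := units_top G (fun e' he' p => H.par p e e' he he')
  have ht : t ∈ G := by rw [this]; trivial
  exact ht p

lemma UP.addv {g : ℂ → F × F} (H : UP g) (v p q : ℂ) :
    g (p + v) - g p = g (q + v) - g q := by
  let G : AddSubgroup ℂ :=
    { carrier := {t | ∀ p q, g (p + t) - g p = g (q + t) - g q}
      zero_mem' := by intro p q; simp
      add_mem' := by
        intro a b ha hb p q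
        have h1 := ha p q
        have h2 := hb (p + a) (q + a)
        rw [← add_assoc, ← add_assoc]
        have := congrArg₂ (· + ·) h2 h1
        simpa using this
      neg_mem' := by
        intro a ha p q
        have := ha (p + -a) (q + -a)
        rw [neg_add_cancel_right, neg_add_cancel_right] at this
        rw [← neg_sub, this, neg_sub] }
  have : G = ⊤ := units_top G (fun e he p q => by
    have h := H.addunit e he (q - p) p
    rw [add_sub_cancel] at h
    exact h.symm)
  have ht : v ∈ G := by rw [this]; trivial
  exact ht p q

end geom

section lin
variable {F : Type*} [Field F]

lemma dt_inv {x x' : F × F} (h1 : dt x x' = 1) (h2 : x.1 * x'.2 = x.2 * x'.1) :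
    dt x x * x'.1 = x.1 ∧ dt x x * x'.2 = x.2 := by
  simp only [dt] at *
  constructor
  · linear_combination x.1 * h1 - x.2 * h2
  · linear_combination x.2 * h1 + x.1 * h2

lemma par_alg [CharZero F] {u x x' t : F × F} (hu : dt u u = 1)
    (h1 : dt x x' = 1) (h2 : x.1 * x'.2 = x.2 * x'.1)
    (h3 : dt (u - x) (u + t) = 1) (h4 : (u - x).1 * (u + t).2 = (u - x).2 * (u + t).1)
    (h5 : dt (x' - u) t = 1) (h6 : (x' - u).1 * t.2 = (x' - u).2 * t.1) :
    x = dt u x • u := by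
  obtain ⟨a1, a2⟩ := dt_inv h1 h2
  obtain ⟨b1, b2⟩ := dt_inv h3 h4
  obtain ⟨c1, c2⟩ := dt_inv h5 h6
  have hM : dt x x * dt (x' - u) (x' - u) = dt (u - x) (u - x) := by
    simp only [dt, Prod.fst_sub, Prod.snd_sub, Prod.fst_add, Prod.snd_add] at *
    linear_combination h1 + (x'.1 - 2 * u.1) * a1 + (x'.2 - 2 * u.2) * a2 + (x.1 * x.1 + x.2 * x.2 - 1) * hu
  have hM2 : dt (u - x) (u - x) = 1 - 2 * dt u x + dt x x := by
    simp only [dt, Prod.fst_sub, Prod.snd_sub] at *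
    linear_combination hu
  have h2' : (2 : F) ≠ 0 := two_ne_zero
  simp only [Prod.fst_sub, Prod.snd_sub, Prod.fst_add, Prod.snd_add] at *
  ext
  · apply mul_left_cancel₀ h2'
    simp only [Prod.smul_fst, smul_eq_mul]
    linear_combination b1 - dt x x * c1 + t.1 * hM - a1 - u.1 * hM2
  · apply mul_left_cancel₀ h2'
    simp only [Prod.smul_snd, smul_eq_mul]
    linear_combination b2 - dt x x * c2 + t.2 * hM - a2 - u.2 * hM2

variable [CharZero F]

lemma lin_rat (L : ℂ →+ F × F) (hL : ∀ e, nq e = 1 → dt (L e) (L e) = 1) (q : ℚ) (hq : q ≠ 0)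
    (v : ℂ) (hv : nq v = (q : ℝ) ^ 2) : dt (L v) (L v) = (q : F) ^ 2 := by
  have hq' : (q : ℝ) ≠ 0 := by exact_mod_cast hq
  have he : nq (((q : ℝ)⁻¹) • v) = 1 := by
    simp only [nq, Complex.smul_re, Complex.smul_im, smul_eq_mul] at *
    field_simp; exact hv
  have h := hL _ he
  have hv2 : v = (q : ℝ) • ((q : ℝ)⁻¹ • v) := by rw [smul_inv_smul₀ hq']
  have h2 := map_ratCast_smul L ℝ F q ((q : ℝ)⁻¹ • v)
  rw [← hv2] at h2
  rw [h2]
  simp only [dt, Prod.smul_fst, Prod.smul_snd, smul_eq_mul] at *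
  linear_combination (q : F) ^ 2 * h

lemma lin_orth (L : ℂ →+ F × F) (hL : ∀ e, nq e = 1 → dt (L e) (L e) = 1) (q : ℚ) (hq : q ≠ 0)
    (e : ℂ) (he : nq e = 1) (a b : ℝ) (hab : a ^ 2 + b ^ 2 = (q : ℝ) ^ 2) :
    dt (L (a • e)) (L (b • (Complex.I * e))) = 0 ∧
    dt (L (a • e)) (L (a • e)) + dt (L (b • (Complex.I * e))) (L (b • (Complex.I * e)))
      = (q : F) ^ 2 := by
  have h1 := lin_rat L hL q hq (a • e + b • (Complex.I * e)) (by
    simp [nq] at *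
    linear_combination (a ^ 2 + b ^ 2) * he + hab)
  have h2 := lin_rat L hL q hq (a • e - b • (Complex.I * e)) (by
    simp [nq] at *
    linear_combination (a ^ 2 + b ^ 2) * he + hab)
  rw [map_add] at h1
  rw [map_sub] at h2
  generalize L (a • e) = x at *
  generalize L (b • (Complex.I * e)) = y at *
  simp only [dt, Prod.fst_sub, Prod.snd_sub, Prod.fst_add, Prod.snd_add] at *
  constructor
  · apply mul_left_cancel₀ (by norm_num : (4 : F) ≠ 0)
    linear_combination h1 - h2
  · apply mul_left_cancel₀ (two_ne_zero : (2 : F) ≠ 0)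
    linear_combination h1 + h2

lemma lin_inv (L : ℂ →+ F × F) (hL : ∀ e, nq e = 1 → dt (L e) (L e) = 1)
    (hi : ∀ v, L v = 0 → v = 0) (e : ℂ) (he : nq e = 1) (y : ℝ) (hy : y ≠ 0) :
    dt (L (y • e)) (L (y⁻¹ • e)) = 1 ∧
      (L (y • e)).1 * (L (y⁻¹ • e)).2 = (L (y • e)).2 * (L (y⁻¹ • e)).1 := by
  obtain ⟨m, hm⟩ := exists_nat_gt (2 * |(y + y⁻¹) / 2| + 1)
  set c := (y + y⁻¹) / 2 with hc
  set d := (y - y⁻¹) / 2 with hd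
  have hcd : c ^ 2 - d ^ 2 = 1 := by rw [hc, hd]; field_simp; ring
  have hm1 : (1 : ℝ) < m := by linarith [abs_nonneg c]
  have hmQ : (1 : ℚ) < m := by exact_mod_cast (by exact_mod_cast hm1 : 1 < m)
  set q : ℚ := (m + (m : ℚ)⁻¹) / 2 with hq
  set r : ℚ := (m - (m : ℚ)⁻¹) / 2 with hr
  have hinv : (m : ℚ)⁻¹ < 1 := inv_lt_one_of_one_lt₀ hmQ
  have hinv0 : 0 < (m : ℚ)⁻¹ := by positivity
  have hq0 : q ≠ 0 := by rw [hq]; positivity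
  have hr0 : r ≠ 0 := by
    have : 0 < r := by rw [hr]; linarith
    exact this.ne'
  have hqr : q ^ 2 = r ^ 2 + 1 := by rw [hq, hr]; field_simp; ring
  have hqm : |c| < (q : ℝ) := by
    have h1 : (m : ℚ) / 2 < q := by rw [hq]; linarith
    have h2 : (m : ℝ) / 2 < (q : ℝ) := by
      have h3 := (Rat.cast_lt (K := ℝ)).mpr h1
      rwa [Rat.cast_div, Rat.cast_natCast, Rat.cast_ofNat] at h3
    linarith
  have hpos : 0 < (q : ℝ) ^ 2 - c ^ 2 := by
    have := sq_lt_sq' (by linarith [abs_nonneg c]) hqm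
    rw [sq_abs] at this; linarith
  obtain ⟨k, hk⟩ : ∃ k : ℝ, k ^ 2 = (q : ℝ) ^ 2 - c ^ 2 := ⟨_, Real.sq_sqrt hpos.le⟩
  have hqrR : (q : ℝ) ^ 2 = (r : ℝ) ^ 2 + 1 := by exact_mod_cast hqr
  have hqrF : (q : F) ^ 2 = (r : F) ^ 2 + 1 := by exact_mod_cast hqr
  obtain ⟨o1, n1⟩ := lin_orth L hL q hq0 e he c k (by linarith)
  obtain ⟨o2, n2⟩ := lin_orth L hL r hr0 e he d k (by linarith)
  have hk0 : k ≠ 0 := by rintro rfl; norm_num at hk; linarith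
  have he0 : e ≠ 0 := by rintro rfl; norm_num [nq] at he
  have hw : L (k • (Complex.I * e)) ≠ 0 := by
    intro h
    have := hi _ h
    simp [hk0, he0] at this
  have hp := dt_perp_par hw o1 o2
  have hy1 : y • e = c • e + d • e := by rw [← add_smul, hc, hd]; congr 1; ring
  have hy2 : y⁻¹ • e = c • e - d • e := by rw [← sub_smul, hc, hd]; congr 1; ring
  rw [hy1, hy2, map_add, map_sub]
  generalize L (c • e) = x at *
  generalize L (d • e) = z at *
  simp only [dt, Prod.fst_sub, Prod.snd_sub, Prod.fst_add, Prod.snd_add] at *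
  constructor
  · linear_combination n1 - n2 + hqrF
  · linear_combination -2 * hp

lemma lin_par (L : ℂ →+ F × F) (hL : ∀ e, nq e = 1 → dt (L e) (L e) = 1)
    (hi : ∀ v, L v = 0 → v = 0) (e : ℂ) (he : nq e = 1) (b : ℝ) :
    L (b • e) = dt (L e) (L (b • e)) • L e := by
  by_cases hb0 : b = 0
  · subst hb0; simp [dt]
  by_cases hb1 : b = 1
  · subst hb1; rw [one_smul, hL e he, one_smul]
  have hb2 : 1 - b ≠ 0 := sub_ne_zero.mpr (Ne.symm hb1)
  have hb3 : b⁻¹ - 1 ≠ 0 := by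
    intro h
    apply hb1
    rw [sub_eq_zero, inv_eq_one] at h
    exact h
  obtain ⟨h1, h2⟩ := lin_inv L hL hi e he b hb0
  obtain ⟨h3, h4⟩ := lin_inv L hL hi e he (1 - b) hb2
  obtain ⟨h5, h6⟩ := lin_inv L hL hi e he (b⁻¹ - 1) hb3
  have e1 : (1 - b) • e = e - b • e := by rw [sub_smul, one_smul]
  have e2 : (b⁻¹ - 1) • e = b⁻¹ • e - e := by rw [sub_smul, one_smul]
  have e3 : (1 - b)⁻¹ • e = e + (b⁻¹ - 1)⁻¹ • e := by
    have : (1 - b)⁻¹ = 1 + (b⁻¹ - 1)⁻¹ := by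
      have : b⁻¹ - 1 = (1 - b) / b := by field_simp
      rw [this]; field_simp; ring
    rw [this, add_smul, one_smul]
  rw [e1, e3, map_sub, map_add] at h3 h4
  rw [e2, map_sub] at h5 h6
  exact par_alg (hL e he) h1 h2 h3 h4 h5 h6

lemma lin_perp (L : ℂ →+ F × F) (hL : ∀ e, nq e = 1 → dt (L e) (L e) = 1)
    (hi : ∀ v, L v = 0 → v = 0) (v w : ℂ) (h : v.re * w.re + v.im * w.im = 0) :
    dt (L v) (L w) = 0 := by
  by_cases hv : v = 0
  · subst hv; simp [dt]
  set a := ‖v‖ with ha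
  have ha0 : a ≠ 0 := by rw [ha]; exact norm_ne_zero_iff.mpr hv
  have ha2 : a ^ 2 = v.re ^ 2 + v.im ^ 2 := by
    rw [ha, Complex.sq_norm, Complex.normSq_apply]; ring
  set e : ℂ := a⁻¹ • v with hed
  have hve : v = a • e := by rw [hed, smul_inv_smul₀ ha0]
  have he : nq e = 1 := by
    simp only [nq, hed, Complex.smul_re, Complex.smul_im, smul_eq_mul]
    field_simp; exact ha2.symm
  have hIe : nq (Complex.I * e) = 1 := by
    simp [nq] at *; linarith
  have hre : v.re = a * e.re := by rw [hve]; simp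
  have him : v.im = a * e.im := by rw [hve]; simp
  have h' : e.re * w.re + e.im * w.im = 0 := by
    apply mul_left_cancel₀ ha0
    rw [hre, him] at h; linarith
  have hw : w = (e.re * w.im - e.im * w.re) • (Complex.I * e) := by
    simp only [nq] at he
    apply Complex.ext
    · simp
      linear_combination (-w.re) * he + e.re * h'
    · simp
      linear_combination (-w.im) * he + e.im * h'
  have hee : dt (L e) (L (Complex.I * e)) = 0 := by
    obtain ⟨o, -⟩ := lin_orth L hL 5 (by norm_num) e he 3 4 (by norm_num)
    have t3 := map_ratCast_smul L ℝ F 3 e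
    have t4 := map_ratCast_smul L ℝ F 4 (Complex.I * e)
    norm_num at t3 t4
    rw [Complex.real_smul, Complex.real_smul] at o
    norm_num at o
    rw [t3, t4] at o
    simp only [dt, Prod.smul_fst, Prod.smul_snd, smul_eq_mul] at *
    apply mul_left_cancel₀ (by norm_num : (12 : F) ≠ 0)
    linear_combination o
  rw [hve, hw, lin_par L hL hi e he a, lin_par L hL hi _ hIe]
  generalize dt (L e) (L (a • e)) = k1
  generalize dt (L (Complex.I * e)) _ = k2
  simp only [dt, Prod.smul_fst, Prod.smul_snd, smul_eq_mul] at *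
  linear_combination k1 * k2 * hee

end lin

/-- **Theorem 9.** If `P, Q, X, Y ∈ ℝ²`, the vector `Q - P` is perpendicular
to the vector `Y - X` (their standard dot product vanishes), and
`f : ℝ² → F²` preserves unit distance, then `f Q - f P` is perpendicular to
`f Y - f X` (their dot product in `F²` vanishes). -/
theorem stmt_18 (F : Type*) [Field F] [CharZero F]
    (f : EuclideanSpace ℝ (Fin 2) → (Fin 2 → F))
    (hf : ∀ x y : EuclideanSpace ℝ (Fin 2), dist x y = 1 →
      ∑ i, (f x i - f y i) ^ 2 = 1)
    (P Q X Y : EuclideanSpace ℝ (Fin 2))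
    (h : ∑ i, (Q i - P i) * (Y i - X i) = 0) :
    ∑ i, (f Q i - f P i) * (f Y i - f X i) = 0 := by
  let c : ℂ → EuclideanSpace ℝ (Fin 2) := fun z => !₂[z.re, z.im]
  let g : ℂ → F × F := fun z => (f (c z) 0, f (c z) 1)
  have H : UP g := by
    intro p q hpq
    have hd : dist (c q) (c p) = 1 := by
      rw [EuclideanSpace.dist_eq, Real.sqrt_eq_one]
      simp only [nq, Complex.sub_re, Complex.sub_im] at hpq
      simpa [c, Fin.sum_univ_two, Real.dist_eq, sq_abs] using hpq
    have := hf _ _ hd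
    rw [Fin.sum_univ_two] at this
    simp only [dt, g, Prod.fst_sub, Prod.snd_sub]
    linear_combination this
  let L : ℂ →+ F × F :=
    { toFun := fun v => g v - g 0
      map_zero' := by simp
      map_add' := by
        intro v w
        have := H.addv w v 0
        rw [zero_add] at this
        change g (v + w) - g 0 = (g v - g 0) + (g w - g 0)
        rw [← this]; abel }
  have hLd : ∀ v, L v = g v - g 0 := fun _ => rfl
  have hL : ∀ e, nq e = 1 → dt (L e) (L e) = 1 := by
    intro e he
    exact H 0 e (by simpa using he)
  have hi : ∀ v, L v = 0 → v = 0 := by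
    intro v hv
    by_contra hne
    apply H.inj 0 v hne
    rw [zero_add]
    exact sub_eq_zero.mp hv
  let d : EuclideanSpace ℝ (Fin 2) → ℂ := fun x => ⟨x 0, x 1⟩
  have hcd : ∀ x, c (d x) = x := by
    intro x
    ext i
    fin_cases i <;> simp [c, d]
  have hg : ∀ x, g (d x) = (f x 0, f x 1) := by
    intro x; simp only [g, hcd]
  have key := lin_perp L hL hi (d Q - d P) (d Y - d X) (by
    rw [Fin.sum_univ_two] at h
    simpa [d] using h)
  rw [map_sub, map_sub] at key
  simp only [hLd, hg, sub_sub_sub_cancel_right] at key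
  rw [Fin.sum_univ_two]
  simpa [dt] using key
end

section
/- Let F be a field of characteristic 0 and f : ℝ² → F² a unit-distance preserving map. If A, B, C, D ∈ ℝ² and |A−B| = |C−D|, then φ₂(f(A),f(B)) = φ₂(f(C),f(D)) (Theorem 10; the special case C = A is Lemma 9). -/
namespace BQ

/-- the quadratic form -/
def q {F : Type*} [Field F] (x : F × F) : F := x.1 ^ 2 + x.2 ^ 2
/-- the bilinear form -/
def b {F : Type*} [Field F] (x y : F × F) : F := x.1 * y.1 + x.2 * y.2
/-- the determinant -/
def dt {F : Type*} [Field F] (x y : F × F) : F := x.1 * y.2 - x.2 * y.1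

section alg
variable {F : Type*} [Field F]

lemma ne_or {x : F × F} (h : x ≠ 0) : x.1 ≠ 0 ∨ x.2 ≠ 0 := by
  by_contra hc
  push Not at hc
  exact h (Prod.ext hc.1 hc.2)

lemma dt_of_b {h x y : F × F} (hh : h ≠ 0) (hx : b x h = 0) (hy : b y h = 0) : dt x y = 0 := by
  unfold b at *
  unfold dt
  rcases ne_or hh with h1 | h1 <;> apply mul_left_cancel₀ h1 <;> grind

lemma b_of_dt {h x y : F × F} (hx0 : x ≠ 0) (hx : b x h = 0) (hy : dt x y = 0) : b y h = 0 := by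
  unfold b dt at *
  rcases ne_or hx0 with h1 | h1 <;> apply mul_left_cancel₀ h1 <;> grind

lemma dt_trans {x y z : F × F} (hy0 : y ≠ 0) (hx : dt x y = 0) (hz : dt y z = 0) : dt x z = 0 := by
  unfold dt at *
  rcases ne_or hy0 with h1 | h1 <;> apply mul_left_cancel₀ h1 <;> grind

lemma rhomb [CharZero F] {P Q R S : F × F} (h1 : q (P - Q) = 1) (h2 : q (Q - R) = 1)
    (h3 : q (R - S) = 1) (h4 : q (S - P) = 1) (hPR : P ≠ R) (hQS : Q ≠ S) :
    P + R = Q + S := by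
  by_contra hm
  have hm' : P + R - Q - S ≠ 0 := by
    intro h
    apply hm
    rw [sub_sub, sub_eq_zero] at h
    exact h
  have hd : S - Q ≠ 0 := sub_ne_zero.2 hQS.symm
  have hbd : b (S - Q) (P + R - Q - S) = 0 := by
    have : (2 : F) * b (S - Q) (P + R - Q - S) = 0 := by
      simp only [b, q, Prod.fst_sub, Prod.snd_sub, Prod.fst_add, Prod.snd_add] at *
      linear_combination h1 + h2 - h3 - h4
    simpa using this
  have hbe : b (R - P) (P + R - Q - S) = 0 := by
    have : (2 : F) * b (R - P) (P + R - Q - S) = 0 := by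
      simp only [b, q, Prod.fst_sub, Prod.snd_sub, Prod.fst_add, Prod.snd_add] at *
      linear_combination h2 + h3 - h1 - h4
    simpa using this
  have hde : b (R - P) (S - Q) = 0 := by
    have : (2 : F) * b (R - P) (S - Q) = 0 := by
      simp only [b, q, Prod.fst_sub, Prod.snd_sub, Prod.fst_add, Prod.snd_add] at *
      linear_combination -h1 + h2 - h3 + h4
    simpa using this
  have he : R - P ≠ 0 := sub_ne_zero.2 hPR.symm
  have hdd : b (S - Q) (S - Q) = 0 := b_of_dt he hde (dt_of_b hm' hbe hbd)
  have hP : b (2 • P - Q - S) (S - Q) = 0 := by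
    simp only [b, q, two_smul, Prod.fst_sub, Prod.snd_sub, Prod.fst_add, Prod.snd_add] at *
    linear_combination h1 - h4
  have hPQ : b (P - Q) (S - Q) = 0 := by
    have : (2 : F) * b (P - Q) (S - Q) = 0 := by
      simp only [b, q, two_smul, Prod.fst_sub, Prod.snd_sub, Prod.fst_add, Prod.snd_add] at *
      linear_combination hP + hdd
    simpa using this
  have := b_of_dt hd (by unfold b at *; linear_combination hPQ : b (S - Q) (P - Q) = 0)
    (dt_of_b hd hdd hPQ)
  simp only [b, q] at *
  have h0 : (1 : F) = 0 := by rw [← h1]; linear_combination this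
  exact one_ne_zero h0

end alg

section subgroup

lemma one_mem_of (W : AddSubgroup ℝ) (hhalf : ∀ x, 2 * x ∈ W → x ∈ W)
    (hinv : ∀ x ∈ W, x ≠ 0 → x⁻¹ ∈ W)
    (hsq : ∀ x ∈ W, x ≠ 0 → √(x ^ 2 + 1) ∈ W) (t : ℝ) (ht : t ∈ W) (ht0 : t ≠ 0) :
    (1 : ℝ) ∈ W := by
  have hinv' : ∀ x ∈ W, x⁻¹ ∈ W := by
    intro x hx
    by_cases h : x = 0
    · simpa [h] using hx
    · exact hinv x hx h
  have hua : ∀ a ∈ W, ∀ c ∈ W, a ^ 2 * c ∈ W := by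
    intro a ha c hc
    by_cases ha0 : a = 0
    · simp [ha0, W.zero_mem]
    by_cases hc0 : c = 0
    · simp [hc0, W.zero_mem]
    by_cases hac : 1 - a * c = 0
    · have : a ^ 2 * c = a := by linear_combination (-a) * hac
      rwa [this]
    have h := W.sub_mem ha (hinv' _ (W.add_mem (hinv' _ ha)
      (hinv' _ (W.sub_mem (hinv' _ hc) ha))))
    have e1 : c⁻¹ - a = (1 - a * c) / c := by field_simp
    have e2 : a⁻¹ + (c⁻¹ - a)⁻¹ = 1 / (a * (1 - a * c)) := by
      rw [e1]
      field_simp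
      ring
    rw [e2] at h
    convert h using 1
    field_simp
    ring
  have htri : ∀ a ∈ W, ∀ c ∈ W, ∀ d ∈ W, a * c * d ∈ W := by
    intro a ha c hc d hd
    apply hhalf
    have := W.sub_mem (W.sub_mem (hua _ (W.add_mem ha hc) d hd) (hua a ha d hd)) (hua c hc d hd)
    convert this using 1
    ring
  have hw := hsq t ht ht0
  have hti := hinv t ht ht0
  have hw2 := hinv' _ (hsq _ hti (inv_ne_zero ht0))
  have h3 := htri _ (htri _ hw _ hw2 _ hti)
  have hpos : (0 : ℝ) < t ^ 2 + 1 := by positivity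
  have e : √(t⁻¹ ^ 2 + 1) = √(t ^ 2 + 1) / |t| := by
    rw [← Real.sqrt_sq_eq_abs, ← Real.sqrt_div hpos.le]
    congr 1
    field_simp
    ring
  have h3 := htri _ hw _ hw2 _ hti
  have hs : √(t ^ 2 + 1) ≠ 0 := (Real.sqrt_pos.2 hpos).ne'
  rw [e] at h3
  have ha : |t| ≠ 0 := abs_ne_zero.2 ht0
  have e4 : √(t ^ 2 + 1) * (√(t ^ 2 + 1) / |t|)⁻¹ * t⁻¹ = |t| / t := by
    field_simp
  rw [e4] at h3
  rcases abs_choice t with h | h <;> rw [h] at h3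
  · rwa [div_self ht0] at h3
  · rw [neg_div, div_self ht0] at h3
    simpa using W.neg_mem h3

end subgroup

section additive
variable {F : Type*} [Field F] [CharZero F]

lemma g_nat (g : ℂ →+ F × F) (hu : ∀ z, ‖z‖ = 1 → q (g z) = 1) (n : ℕ) (z : ℂ) (hz : ‖z‖ = n) :
    q (g z) = (n : F) ^ 2 := by
  rcases Nat.eq_zero_or_pos n with rfl | hn
  · have : z = 0 := by simpa using hz
    simp [this, q]
  have hn0 : (n : ℂ) ≠ 0 := by exact_mod_cast hn.ne'
  have hn1 : (n : ℝ) ≠ 0 := by exact_mod_cast hn.ne'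
  have e : z = n • (z / n) := by
    rw [nsmul_eq_mul]
    field_simp
  have h1 := hu (z / n) (by rw [norm_div, hz, Complex.norm_natCast, div_self hn1])
  rw [e, map_nsmul]
  simp only [q, Prod.smul_fst, Prod.smul_snd] at *
  simp only [nsmul_eq_mul]
  linear_combination (n : F) ^ 2 * h1

lemma norm_sq_lin (a : ℂ) (ha : ‖a‖ = 1) (r s : ℝ) :
    ‖(r : ℂ) * a + s * (Complex.I * a)‖ ^ 2 = r ^ 2 + s ^ 2 := by
  have : (r : ℂ) * a + s * (Complex.I * a) = (r + s * Complex.I) * a := by ring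
  rw [this, norm_mul, ha, mul_one, ← Complex.normSq_eq_norm_sq, Complex.normSq_add_mul_I]

lemma orth_nat (g : ℂ →+ F × F) (hu : ∀ z, ‖z‖ = 1 → q (g z) = 1) (a : ℂ) (ha : ‖a‖ = 1)
    (r s : ℝ) (n : ℕ) (h : r ^ 2 + s ^ 2 = n ^ 2) : b (g (r * a)) (g (s * (Complex.I * a))) = 0 := by
  have hnn : ∀ z : ℂ, ‖z‖ ^ 2 = (n : ℝ) ^ 2 → ‖z‖ = n := fun z hz =>
    (pow_left_inj₀ (norm_nonneg z) (Nat.cast_nonneg n) two_ne_zero).1 hz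
  have h1 := g_nat g hu n _ (hnn _ ((norm_sq_lin a ha r s).trans h))
  have h2 := g_nat g hu n _ (hnn _ ((norm_sq_lin a ha r (-s)).trans (by rw [neg_sq]; exact h)))
  have e : (r : ℂ) * a + ((-s : ℝ) : ℂ) * (Complex.I * a) = r * a - s * (Complex.I * a) := by
    push_cast; ring
  rw [e] at h2
  rw [map_add] at h1
  rw [map_sub] at h2
  have : (4 : F) * b (g (r * a)) (g (s * (Complex.I * a))) = 0 := by
    simp only [b, q, Prod.fst_sub, Prod.snd_sub, Prod.fst_add, Prod.snd_add] at *
    linear_combination h1 - h2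
  simpa using this

lemma dt_of_sq (g : ℂ →+ F × F) (hinj : ∀ z, z ≠ 0 → g z ≠ 0)
    (hu : ∀ z, ‖z‖ = 1 → q (g z) = 1) (a : ℂ) (ha : ‖a‖ = 1) (x y : ℝ) (h : x ^ 2 - y ^ 2 = 1) :
    dt (g (x * a)) (g (y * a)) = 0 := by
  obtain ⟨k, hk⟩ := exists_nat_gt (2 * |y| + 2)
  have hy := abs_nonneg y
  have hk1 : 1 ≤ k := by
    have : (1 : ℝ) ≤ k := by linarith
    exact_mod_cast this
  have hlt : 2 * k * |y| < (k : ℝ) ^ 2 - 1 := by nlinarith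
  have hpos : 0 < ((k : ℝ) ^ 2 - 1) ^ 2 - (2 * k * y) ^ 2 := by
    have h0 : (0 : ℝ) ≤ 2 * k * |y| := by positivity
    have : (2 * k * y) ^ 2 = (2 * k * |y|) ^ 2 := by rw [mul_pow, mul_pow _ |y|, sq_abs]
    rw [this]
    nlinarith
  set s := √(((k : ℝ) ^ 2 - 1) ^ 2 - (2 * k * y) ^ 2) with hs
  have hs0 : s ≠ 0 := (Real.sqrt_pos.2 hpos).ne'
  have hs2 : s ^ 2 = ((k : ℝ) ^ 2 - 1) ^ 2 - (2 * k * y) ^ 2 := Real.sq_sqrt hpos.le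
  have hc : ((k ^ 2 - 1 : ℕ) : ℝ) = (k : ℝ) ^ 2 - 1 := by
    rw [Nat.cast_sub (Nat.one_le_pow _ _ hk1)]; push_cast; ring
  have h1 := orth_nat g hu a ha (2 * k * y) s (k ^ 2 - 1) (by rw [hc, hs2]; ring)
  have h2 := orth_nat g hu a ha (2 * k * x) s (k ^ 2 + 1) (by
    push_cast; rw [hs2]; linear_combination 4 * (k : ℝ) ^ 2 * h)
  have ha0 : a ≠ 0 := by
    rintro rfl
    simp at ha
  have hH : g (s * (Complex.I * a)) ≠ 0 := hinj _ (by
    simp [ha0, hs0])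
  have h3 := dt_of_b hH h2 h1
  have e : ∀ z : ℝ, g (((2 * k * z : ℝ) : ℂ) * a) = (2 * k) • g (z * a) := by
    intro z
    rw [← map_nsmul, nsmul_eq_mul]
    congr 1
    push_cast; ring
  rw [e, e] at h3
  have hk0 : (k : F) ≠ 0 := by
    have : k ≠ 0 := by omega
    exact_mod_cast this
  have : (4 * (k : F) ^ 2) * dt (g (x * a)) (g (y * a)) = 0 := by
    simp only [dt, Prod.smul_fst, Prod.smul_snd] at *
    simp only [nsmul_eq_mul] at h3
    push_cast at h3
    linear_combination h3
  simpa [hk0] using this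

/-- the reals `r` with `g (r a)` parallel to `g (r₀ a)` -/
def W (g : ℂ →+ F × F) (a : ℂ) (r₀ : ℝ) : AddSubgroup ℝ where
  carrier := {r | dt (g (r * a)) (g (r₀ * a)) = 0}
  zero_mem' := by simp [dt]
  add_mem' := by
    intro x y hx hy
    simp only [Set.mem_ofPred_eq, dt, Complex.ofReal_add, add_mul, map_add, Prod.fst_add,
      Prod.snd_add] at *
    linear_combination hx + hy
  neg_mem' := by
    intro x hx
    simp only [Set.mem_ofPred_eq, dt, Complex.ofReal_neg, neg_mul, map_neg, Prod.fst_neg,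
      Prod.snd_neg] at *
    linear_combination -hx

lemma mem_W (g : ℂ →+ F × F) (a : ℂ) (r₀ r : ℝ) :
    r ∈ W g a r₀ ↔ dt (g (r * a)) (g (r₀ * a)) = 0 := Iff.rfl

lemma par_one (g : ℂ →+ F × F) (hinj : ∀ z, z ≠ 0 → g z ≠ 0)
    (hu : ∀ z, ‖z‖ = 1 → q (g z) = 1) (a : ℂ) (ha : ‖a‖ = 1) (r₀ : ℝ) (h0 : r₀ ≠ 0) :
    dt (g ((1 : ℝ) * a)) (g (r₀ * a)) = 0 := by
  have ha0 : a ≠ 0 := by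
    rintro rfl
    simp at ha
  rw [← mem_W]
  apply one_mem_of (W g a r₀) _ _ _ r₀ _ h0
  · intro x hx
    rw [mem_W] at *
    have e : ((2 * x : ℝ) : ℂ) * a = x * a + x * a := by push_cast; ring
    rw [e, map_add] at hx
    have : (2 : F) * dt (g (x * a)) (g (r₀ * a)) = 0 := by
      simp only [dt, Prod.fst_add, Prod.snd_add] at *
      linear_combination hx
    simpa using this
  · intro t ht ht0
    rw [mem_W] at *
    apply dt_trans (y := g (t * a)) (hinj _ (by simp [ht0, ha0])) _ ht
    have h := dt_of_sq g hinj hu a ha ((t + t⁻¹) / 2) ((t - t⁻¹) / 2) (by field_simp; ring)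
    have e1 : (t : ℂ) * a = (((t + t⁻¹) / 2 : ℝ) : ℂ) * a + (((t - t⁻¹) / 2 : ℝ) : ℂ) * a := by
      push_cast; ring
    have e2 : ((t⁻¹ : ℝ) : ℂ) * a
        = (((t + t⁻¹) / 2 : ℝ) : ℂ) * a - (((t - t⁻¹) / 2 : ℝ) : ℂ) * a := by
      push_cast; ring
    rw [e1, e2, map_add, map_sub]
    simp only [dt, Prod.fst_add, Prod.snd_add, Prod.fst_sub, Prod.snd_sub] at *
    linear_combination 2 * h
  · intro t ht ht0
    rw [mem_W] at *
    apply dt_trans (y := g (t * a)) (hinj _ (by simp [ht0, ha0])) _ ht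
    apply dt_of_sq g hinj hu a ha
    rw [Real.sq_sqrt (by positivity)]
    ring
  · rw [mem_W]
    unfold dt
    ring

lemma orth_all (g : ℂ →+ F × F) (hinj : ∀ z, z ≠ 0 → g z ≠ 0)
    (hu : ∀ z, ‖z‖ = 1 → q (g z) = 1) (a : ℂ) (ha : ‖a‖ = 1) (r s : ℝ) :
    b (g (r * a)) (g (s * (Complex.I * a))) = 0 := by
  have ha0 : a ≠ 0 := by
    rintro rfl
    simp at ha
  by_cases hr : r = 0
  · simp [hr, b]
  obtain ⟨n, hn⟩ := exists_nat_gt |s|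
  have hpos : 0 < (n : ℝ) ^ 2 - s ^ 2 := by
    have := abs_nonneg s
    rw [← sq_abs s]
    nlinarith
  have hs0 : √((n : ℝ) ^ 2 - s ^ 2) ≠ 0 := (Real.sqrt_pos.2 hpos).ne'
  have h1 := orth_nat g hu a ha (√((n : ℝ) ^ 2 - s ^ 2)) s n (by
    rw [Real.sq_sqrt hpos.le]; ring)
  have h2 := par_one g hinj hu a ha _ hs0
  have h3 := par_one g hinj hu a ha _ hr
  have hsym : ∀ x y : F × F, dt x y = 0 → dt y x = 0 := by
    intro x y h
    unfold dt at *
    linear_combination -h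
  exact b_of_dt (hinj _ (by simp [hs0, ha0])) h1
    (dt_trans (hinj _ (by simp [ha0])) (hsym _ _ h2) h3)

lemma g_main (g : ℂ →+ F × F) (hinj : ∀ z, z ≠ 0 → g z ≠ 0)
    (hu : ∀ z, ‖z‖ = 1 → q (g z) = 1) (x y : ℂ) (h : ‖x‖ = ‖y‖) : q (g x) = q (g y) := by
  by_cases hxy : x = y
  · rw [hxy]
  have hp : x - y ≠ 0 := sub_ne_zero.2 hxy
  have hpn : ‖x - y‖ ≠ 0 := norm_ne_zero_iff.2 hp
  have hpc : (‖x - y‖ : ℂ) ≠ 0 := by exact_mod_cast hpn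
  have ha : ‖(x - y) / ‖x - y‖‖ = 1 := by
    rw [norm_div, Complex.norm_real, norm_norm, div_self hpn]
  have hre : ((x + y) / (x - y)).re = 0 := by
    rw [Complex.div_re, ← add_div]
    have : (x + y).re * (x - y).re + (x + y).im * (x - y).im = 0 := by
      have h2 : Complex.normSq x = Complex.normSq y := by
        rw [Complex.normSq_eq_norm_sq, Complex.normSq_eq_norm_sq, h]
      rw [Complex.normSq_apply, Complex.normSq_apply] at h2
      simp only [Complex.add_re, Complex.sub_re, Complex.add_im, Complex.sub_im]
      linear_combination h2
    rw [this, zero_div]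
  have him : (x + y) / (x - y) = (((x + y) / (x - y)).im : ℂ) * Complex.I := by
    apply Complex.ext <;> simp [hre]
  have key := orth_all g hinj hu _ ha ‖x - y‖ (‖x - y‖ * ((x + y) / (x - y)).im)
  have e1 : (‖x - y‖ : ℂ) * ((x - y) / ‖x - y‖) = x - y := by field_simp
  have e2 : ((‖x - y‖ * ((x + y) / (x - y)).im : ℝ) : ℂ) * (Complex.I * ((x - y) / ‖x - y‖))
      = x + y := by
    calc _ = ((((x + y) / (x - y)).im : ℂ) * Complex.I) * (‖x - y‖ * ((x - y) / ‖x - y‖)) := by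
            push_cast; ring
      _ = x + y := by rw [← him, e1]; field_simp
  rw [e1, e2, map_sub, map_add] at key
  simp only [b, q, Prod.fst_add, Prod.snd_add, Prod.fst_sub, Prod.snd_sub] at *
  linear_combination key

end additive

section plane

/-- two circles meet -/
lemma triangle_exists (A B : ℂ) (hAB : A ≠ B) (m n : ℝ) (hm : 0 ≤ m) (hn : 0 ≤ n)
    (h1 : |m - n| ≤ ‖A - B‖) (h2 : ‖A - B‖ ≤ m + n) : ∃ C : ℂ, ‖A - C‖ = m ∧ ‖B - C‖ = n := by
  set d := ‖A - B‖ with hd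
  have hd0 : 0 < d := norm_pos_iff.2 (sub_ne_zero.2 hAB)
  have hdc : (d : ℂ) ≠ 0 := by exact_mod_cast hd0.ne'
  set x := (d ^ 2 + m ^ 2 - n ^ 2) / (2 * d) with hx
  have hx2 : 2 * d * x = d ^ 2 + m ^ 2 - n ^ 2 := by rw [hx]; field_simp
  have hnn : 0 ≤ m ^ 2 - x ^ 2 := by
    have h3 := abs_le.1 h1
    have ha : 0 ≤ (m + n - d) * (m + n + d) := mul_nonneg (by linarith) (by linarith)
    have hb : 0 ≤ (d + (m - n)) * (d - (m - n)) := mul_nonneg (by linarith) (by linarith)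
    have hc := mul_nonneg ha hb
    have : (4 * d ^ 2) * (m ^ 2 - x ^ 2)
        = ((m + n - d) * (m + n + d)) * ((d + (m - n)) * (d - (m - n))) := by
      linear_combination (-(2 * d * x) - (d ^ 2 + m ^ 2 - n ^ 2)) * hx2
    rw [← this] at hc
    exact nonneg_of_mul_nonneg_right hc (by positivity)
  set y := √(m ^ 2 - x ^ 2) with hy
  have hy2 : y ^ 2 = m ^ 2 - x ^ 2 := Real.sq_sqrt hnn
  have hu : ‖(B - A) / d‖ = 1 := by
    rw [norm_div, Complex.norm_real, norm_sub_rev, ← hd, Real.norm_of_nonneg hd0.le,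
      div_self hd0.ne']
  have key : ∀ s t r : ℝ, 0 ≤ r → s ^ 2 + t ^ 2 = r ^ 2 →
      ‖((s : ℂ) + t * Complex.I) * ((B - A) / d)‖ = r := by
    intro s t r hr h
    rw [norm_mul, hu, mul_one]
    apply (pow_left_inj₀ (norm_nonneg _) hr two_ne_zero).1
    rw [← Complex.normSq_eq_norm_sq, Complex.normSq_add_mul_I, h]
  refine ⟨A + ((x : ℂ) + y * Complex.I) * ((B - A) / d), ?_, ?_⟩
  · rw [← key x y m hm (by rw [hy2]; ring), ← norm_neg]
    congr 1
    ring
  · rw [← key (d - x) (-y) n hn (by linear_combination hy2 - hx2)]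
    congr 1
    push_cast
    field_simp
    ring

lemma unit_gen (P : ℂ → Prop) (hadd : ∀ x y, P x → P y → P (x + y))
    (hu : ∀ z, ‖z‖ = 1 → P z) (z : ℂ) : P z := by
  have h0 : P 0 := by
    have := hadd 1 (-1) (hu _ (by simp)) (hu _ (by simp))
    simpa using this
  have h2 : ∀ z, ‖z‖ ≤ 2 → P z := by
    intro z hz
    by_cases h : z = 0
    · rwa [h]
    obtain ⟨C, hC1, hC2⟩ := triangle_exists 0 z (Ne.symm h) 1 1 zero_le_one zero_le_one
      (by simp) (by rw [zero_sub, norm_neg]; linarith)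
    have := hadd C (z - C) (hu _ (by simpa using hC1)) (hu _ hC2)
    simpa using this
  obtain ⟨n, hn⟩ := exists_nat_gt ‖z‖
  have hn0 : (0 : ℝ) < n := lt_of_le_of_lt (norm_nonneg z) hn
  have hnc : (n : ℂ) ≠ 0 := by exact_mod_cast hn0.ne'
  have h3 : P (z / n) := by
    apply h2
    rw [norm_div, Complex.norm_natCast, div_le_iff₀ hn0]
    linarith
  have h4 : ∀ k : ℕ, P (k * (z / n)) := by
    intro k
    induction k with
    | zero => simpa using h0
    | succ k ih =>
      have := hadd _ _ ih h3
      convert this using 1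
      push_cast; ring
  have := h4 n
  rwa [mul_div_cancel₀ _ hnc] at this

end plane

section general
variable {F : Type*} [Field F] [CharZero F]

/-- primitive sixth root of unity -/
noncomputable def om : ℂ := ⟨1 / 2, √3 / 2⟩

lemma om_norm : ‖om‖ = 1 := by
  apply (pow_left_inj₀ (norm_nonneg _) zero_le_one two_ne_zero).1
  rw [← Complex.normSq_eq_norm_sq, Complex.normSq_apply]
  have := Real.sq_sqrt (show (0 : ℝ) ≤ 3 by norm_num)
  simp only [om]
  nlinarith

lemma om_sq : om ^ 2 = om - 1 := by
  have := Real.sq_sqrt (show (0 : ℝ) ≤ 3 by norm_num)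
  rw [sq]
  apply Complex.ext
  · simp only [om, Complex.mul_re, Complex.sub_re, Complex.one_re]
    nlinarith
  · simp only [om, Complex.mul_im, Complex.sub_im, Complex.one_im]
    ring

lemma om_sub_one_norm : ‖om - 1‖ = 1 := by
  rw [← om_sq, norm_pow, om_norm, one_pow]

lemma f_ne (f : ℂ → F × F) (hf : ∀ x y, ‖x - y‖ = 1 → q (f x - f y) = 1)
    (x y : ℂ) (h : ‖x - y‖ = 1) : f x ≠ f y := by
  intro he
  have := hf x y h
  rw [he, sub_self] at this
  simp [q] at this

lemma rh (f : ℂ → F × F) (hf : ∀ x y, ‖x - y‖ = 1 → q (f x - f y) = 1)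
    (p a c : ℂ) (ha : ‖a‖ = 1) (hc : ‖c‖ = 1) (h1 : f p ≠ f (p + a + c))
    (h2 : f (p + a) ≠ f (p + c)) : f p + f (p + a + c) = f (p + a) + f (p + c) := by
  apply rhomb _ _ _ _ h1 h2
  · apply hf; rw [← ha, ← norm_neg]; congr 1; ring
  · apply hf; rw [← hc, ← norm_neg]; congr 1; ring
  · apply hf; rw [← ha]; congr 1; ring
  · apply hf; rw [← hc]; congr 1; ring

lemma tri0 (f : ℂ → F × F) (hf : ∀ x y, ‖x - y‖ = 1 → q (f x - f y) = 1)
    (p a : ℂ) (ha : ‖a‖ = 1) (h1 : f p ≠ f (p + a + om * a)) :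
    f p + f (p + a + om * a) = f (p + a) + f (p + om * a) := by
  apply rh f hf p a (om * a) ha (by rw [norm_mul, om_norm, ha, one_mul]) h1
  apply f_ne f hf
  rw [← norm_neg]
  have : -(p + a - (p + om * a)) = (om - 1) * a := by ring
  rw [this, norm_mul, om_sub_one_norm, ha, one_mul]

lemma tri3 (f : ℂ → F × F) (hf : ∀ x y, ‖x - y‖ = 1 → q (f x - f y) = 1)
    (p a : ℂ) (ha : ‖a‖ = 1) (h1 : f p ≠ f (p + a + om * a)) :
    q (f p - f (p + a + om * a)) = 3 := by
  have h := tri0 f hf p a ha h1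
  have e1 := hf p (p + a) (by rw [← ha, ← norm_neg]; congr 1; ring)
  have e2 := hf p (p + om * a) (by
    rw [sub_add_cancel_left, norm_neg, norm_mul, om_norm, ha, one_mul])
  have e3 := hf (p + a) (p + om * a) (by
    rw [← norm_neg]
    have : -(p + a - (p + om * a)) = (om - 1) * a := by ring
    rw [this, norm_mul, om_sub_one_norm, ha, one_mul])
  have h' : f (p + a + om * a) = f (p + a) + f (p + om * a) - f p := by rw [← h]; abel
  rw [h']
  simp only [q, Prod.fst_add, Prod.snd_add, Prod.fst_sub, Prod.snd_sub] at *
  linear_combination 2 * e1 + 2 * e2 - e3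

lemma tri_ne (f : ℂ → F × F) (hf : ∀ x y, ‖x - y‖ = 1 → q (f x - f y) = 1)
    (p a : ℂ) (ha : ‖a‖ = 1) : f p ≠ f (p + a + om * a) := by
  intro he
  have hne : (1 + om) ≠ 0 := by
    intro h
    have := congrArg Complex.re h
    simp [om] at this
    norm_num at this
  have hn3 : ‖(1 + om) * a‖ ^ 2 = 3 := by
    rw [norm_mul, ha, mul_one, ← Complex.normSq_eq_norm_sq, Complex.normSq_apply]
    have := Real.sq_sqrt (show (0 : ℝ) ≤ 3 by norm_num)
    simp only [om, Complex.add_re, Complex.add_im, Complex.one_re, Complex.one_im]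
    nlinarith
  set N := ‖(1 + om) * a‖ with hN
  have hN0 : 0 ≤ N := norm_nonneg _
  have hN1 : 1 ≤ N := by nlinarith
  have hsub : p - (p + a + om * a) = -((1 + om) * a) := by ring
  obtain ⟨C, hC1, hC2⟩ := triangle_exists p (p + a + om * a)
    (by
      intro h
      have h0 := sub_eq_zero.2 h
      rw [hsub, neg_eq_zero] at h0
      rw [h0, norm_zero] at hN
      rw [hN] at hN1
      linarith) N 1 hN0 zero_le_one
    (by rw [hsub, norm_neg, ← hN, abs_of_nonneg (by linarith)]; linarith)
    (by rw [hsub, norm_neg, ← hN]; linarith)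
  have q1 := hf _ _ hC2
  rw [← he] at q1
  -- `p - C` has norm `√3`
  set c := (C - p) / (1 + om) with hc
  have hcc : C = p + c + om * c := by
    have : (1 + om) * c = C - p := by rw [hc]; field_simp
    linear_combination -this
  have hc1 : ‖c‖ = 1 := by
    rw [hc, norm_div, norm_sub_rev, hC1, hN, norm_mul, ha, mul_one]
    exact div_self (norm_ne_zero_iff.2 hne)
  have hfne : f p ≠ f C := by
    intro h
    rw [h, sub_self] at q1
    simp [q] at q1
  have q3 : q (f p - f C) = 3 := by
    rw [hcc] at hfne ⊢
    exact tri3 f hf p c hc1 hfne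
  rw [q1] at q3
  norm_num at q3

lemma tri (f : ℂ → F × F) (hf : ∀ x y, ‖x - y‖ = 1 → q (f x - f y) = 1)
    (p a : ℂ) (ha : ‖a‖ = 1) :
    f p + f (p + a + om * a) = f (p + a) + f (p + om * a) :=
  tri0 f hf p a ha (tri_ne f hf p a ha)

lemma line2 (f : ℂ → F × F) (hf : ∀ x y, ‖x - y‖ = 1 → q (f x - f y) = 1)
    (p a : ℂ) (ha : ‖a‖ = 1) : f (p + a + a) - f (p + a) = f (p + a) - f p := by
  -- shift by `om * a`, then by `a - om * a`
  have h1 := tri f hf p a ha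
  have hc : ‖(1 - om) * a‖ = 1 := by
    rw [norm_mul, norm_sub_rev, om_sub_one_norm, ha, one_mul]
  have h2 := tri f hf (p + om * a) ((1 - om) * a) hc
  have e : om * ((1 - om) * a) = a := by
    linear_combination (-a) * om_sq
  rw [e] at h2
  have e1 : p + om * a + (1 - om) * a = p + a := by ring
  have e2 : p + om * a + a = p + a + om * a := by ring
  rw [e1, e2] at h2
  have h3 : f (p + a + a) = f (p + a) + f (p + a + om * a) - f (p + om * a) := by
    rw [← h2]; abel
  have h4 : f (p + a + om * a) = f (p + a) + f (p + om * a) - f p := by rw [← h1]; abel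
  rw [h3, h4]
  abel

lemma line_n (f : ℂ → F × F) (hf : ∀ x y, ‖x - y‖ = 1 → q (f x - f y) = 1)
    (p a : ℂ) (ha : ‖a‖ = 1) (n : ℕ) :
    f (p + n * a) - f p = n • (f (p + a) - f p) := by
  have h : ∀ n : ℕ, f (p + n * a + a) - f (p + n * a) = f (p + a) - f p := by
    intro n
    induction n with
    | zero => simp
    | succ n ih =>
      have := line2 f hf (p + n * a) a ha
      rw [ih] at this
      rw [← this]
      congr 2 <;> push_cast <;> ring
  induction n with
  | zero => simp
  | succ n ih =>
    rw [succ_nsmul, ← ih, ← h n]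
    have e : p + ((n + 1 : ℕ) : ℂ) * a = p + n * a + a := by push_cast; ring
    rw [e]
    abel

lemma dist_n (f : ℂ → F × F) (hf : ∀ x y, ‖x - y‖ = 1 → q (f x - f y) = 1)
    (x y : ℂ) (n : ℕ) (h : ‖x - y‖ = n) : q (f x - f y) = (n : F) ^ 2 := by
  rcases Nat.eq_zero_or_pos n with rfl | hn
  · have : x = y := by simpa [sub_eq_zero] using h
    simp [this, q]
  have hn0 : (n : ℂ) ≠ 0 := by exact_mod_cast hn.ne'
  have hn1 : (n : ℝ) ≠ 0 := by exact_mod_cast hn.ne'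
  have ha : ‖(x - y) / n‖ = 1 := by
    rw [norm_div, h, Complex.norm_natCast, div_self hn1]
  have h1 := line_n f hf y _ ha n
  rw [mul_div_cancel₀ _ hn0, add_sub_cancel] at h1
  have h2 := hf (y + (x - y) / n) y (by rw [add_sub_cancel_left, ha])
  rw [h1]
  simp only [q, Prod.smul_fst, Prod.smul_snd] at *
  simp only [nsmul_eq_mul]
  linear_combination (n : F) ^ 2 * h2

lemma inj1 (f : ℂ → F × F) (hf : ∀ x y, ‖x - y‖ = 1 → q (f x - f y) = 1)
    (A B : ℂ) (h : 1 ≤ ‖A - B‖) : f A ≠ f B := by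
  intro he
  obtain ⟨n, hn⟩ := exists_nat_gt ‖A - B‖
  have hAB : A ≠ B := by
    rintro rfl
    norm_num at h
  obtain ⟨C, h1, h2⟩ := triangle_exists A B hAB ((n + 1 : ℕ) : ℝ) n (Nat.cast_nonneg _)
    (Nat.cast_nonneg _) (by push_cast; simpa using h) (by push_cast; linarith)
  have e1 := dist_n f hf _ _ _ h1
  have e2 := dist_n f hf _ _ _ h2
  rw [he, e2] at e1
  have : n ^ 2 = (n + 1) ^ 2 := by exact_mod_cast e1
  have h3 := pow_left_injective two_ne_zero this
  omega

lemma inj (f : ℂ → F × F) (hf : ∀ x y, ‖x - y‖ = 1 → q (f x - f y) = 1)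
    (A B : ℂ) (hAB : A ≠ B) : f A ≠ f B := by
  by_cases h : 1 ≤ ‖A - B‖
  · exact inj1 f hf A B h
  push Not at h
  intro he
  obtain ⟨C, h1, h2⟩ := triangle_exists A B hAB 1 1 zero_le_one zero_le_one (by simp)
    (by linarith)
  have hpos : 0 < ‖A - B‖ := norm_pos_iff.2 (sub_ne_zero.2 hAB)
  obtain ⟨k, hk⟩ := exists_nat_gt (1 / ‖A - B‖)
  rw [div_lt_iff₀ hpos] at hk
  have l1 := line_n f hf C (A - C) h1 k
  have l2 := line_n f hf C (B - C) h2 k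
  rw [add_sub_cancel] at l1 l2
  rw [he, ← l2] at l1
  apply inj1 f hf (C + k * (A - C)) (C + k * (B - C)) _ (sub_left_injective l1)
  have e : C + k * (A - C) - (C + k * (B - C)) = k * (A - B) := by ring
  rw [e, norm_mul, Complex.norm_natCast]
  exact hk.le

lemma shift_unit (f : ℂ → F × F) (hf : ∀ x y, ‖x - y‖ = 1 → q (f x - f y) = 1)
    (a c : ℂ) (ha : ‖a‖ = 1) (hc : ‖c‖ = 1) (p : ℂ) :
    f (p + c + a) - f (p + c) = f (p + a) - f p := by
  by_cases h1 : a = c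
  · rw [← h1]
    exact line2 f hf p a ha
  by_cases h2 : a + c = 0
  · have hc' : c = -a := by linear_combination h2
    have := line2 f hf (p - a) a ha
    rw [sub_add_cancel] at this
    rw [hc', ← sub_eq_add_neg, sub_add_cancel]
    exact this.symm
  have := rh f hf p a c ha hc
    (inj f hf _ _ (by
      intro h
      apply h2
      linear_combination -h))
    (inj f hf _ _ (by
      intro h
      apply h1
      linear_combination h))
  have e : p + c + a = p + a + c := by ring
  have h4 : f (p + a + c) = f (p + a) + f (p + c) - f p := by rw [← this]; abel
  rw [e, h4]
  abel

lemma shift_all (f : ℂ → F × F) (hf : ∀ x y, ‖x - y‖ = 1 → q (f x - f y) = 1)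
    (a : ℂ) (ha : ‖a‖ = 1) (z : ℂ) :
    ∀ p, f (p + z + a) - f (p + z) = f (p + a) - f p := by
  apply unit_gen (fun z => ∀ p, f (p + z + a) - f (p + z) = f (p + a) - f p)
  · intro x y hx hy p
    rw [← hx p, ← hy (p + x), add_assoc p x y]
  · intro c hc p
    exact shift_unit f hf a c ha hc p

lemma additive (f : ℂ → F × F) (hf : ∀ x y, ‖x - y‖ = 1 → q (f x - f y) = 1)
    (z : ℂ) : ∀ p, f (p + z) - f p = f z - f 0 := by
  apply unit_gen (fun z => ∀ p, f (p + z) - f p = f z - f 0)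
  · intro x y hx hy p
    have h1 := hy (p + x)
    have h2 := hx p
    have h3 := hy x
    rw [← add_assoc]
    calc f (p + x + y) - f p = (f (p + x + y) - f (p + x)) + (f (p + x) - f p) := by abel
      _ = (f (x + y) - f x) + (f x - f 0) := by rw [h1, h2, h3]
      _ = _ := by abel
  · intro a ha p
    have := shift_all f hf a ha p 0
    simpa using this

lemma main (f : ℂ → F × F) (hf : ∀ x y, ‖x - y‖ = 1 → q (f x - f y) = 1)
    (A B C D : ℂ) (h : ‖A - B‖ = ‖C - D‖) : q (f A - f B) = q (f C - f D) := by
  have hadd := additive f hf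
  let g : ℂ →+ F × F := AddMonoidHom.mk' (fun z => f z - f 0) (by
    intro x y
    have := hadd y x
    rw [← this]
    abel)
  have hg : ∀ z, g z = f z - f 0 := fun z => rfl
  have hd : ∀ x y, f x - f y = g (x - y) := by
    intro x y
    have := hadd (x - y) y
    rw [add_sub_cancel] at this
    rw [this, hg]
  rw [hd, hd]
  apply g_main g _ _ _ _ h
  · intro z hz
    rw [hg]
    exact sub_ne_zero.2 (inj f hf z 0 hz)
  · intro z hz
    rw [hg]
    exact hf z 0 (by simpa using hz)

end general

end BQ



/-- **Theorem 10.** If `A, B, C, D ∈ ℝ²`, `|A - B| = |C - D|` and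
`f : ℝ² → F²` preserves unit distance, then
`φ₂(f A, f B) = φ₂(f C, f D)`. -/
theorem stmt_19 (F : Type*) [Field F] [CharZero F]
    (f : EuclideanSpace ℝ (Fin 2) → (Fin 2 → F))
    (hf : ∀ x y : EuclideanSpace ℝ (Fin 2), dist x y = 1 →
      ∑ i, (f x i - f y i) ^ 2 = 1)
    (A B C D : EuclideanSpace ℝ (Fin 2)) (h : dist A B = dist C D) :
    ∑ i, (f A i - f B i) ^ 2 = ∑ i, (f C i - f D i) ^ 2 := by
  have key := BQ.main (F := F)
    (fun z => (f (Complex.orthonormalBasisOneI.repr z) 0, f (Complex.orthonormalBasisOneI.repr z) 1))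
    (by
      intro x y hxy
      have := hf (Complex.orthonormalBasisOneI.repr x) (Complex.orthonormalBasisOneI.repr y) (by
        rw [LinearIsometryEquiv.dist_map, dist_eq_norm, hxy])
      simpa [BQ.q, Fin.sum_univ_two] using this)
    (Complex.orthonormalBasisOneI.repr.symm A) (Complex.orthonormalBasisOneI.repr.symm B)
    (Complex.orthonormalBasisOneI.repr.symm C) (Complex.orthonormalBasisOneI.repr.symm D)
    (by rw [← dist_eq_norm, ← dist_eq_norm, LinearIsometryEquiv.dist_map,
          LinearIsometryEquiv.dist_map, h])
  simp only [LinearIsometryEquiv.apply_symm_apply] at key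
  simpa only [BQ.q, Fin.sum_univ_two, Prod.fst_sub, Prod.snd_sub] using key
end
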